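/- arXiv:2410.01489 — 4 statements merged into one kernel-verified Lean document; each statement's English description precedes it below -/
import Mathlib

section
/- (First Maximum Principle) Let (Ω,ρ) be a compact connected metric space, σ a fully supported Borel probability measure, and K : Ω × Ω → [0,∞] a symmetric, extended-continuous kernel which is regular and entirely subharmonic with respect to σ. Then for every finite unsigned Borel measure μ on Ω and M ∈ [0,∞], if U_K^μ(x) ≤ M for all x ∈ supp(μ), then U_K^μ(x) ≤ M for all x ∈ Ω. -/
open MeasureTheory Metric Set ENNReal

/-- The potential of a measure `μ` with respect to a kernel `K`. -/
noncomputable def pot {Ω : Type*} [MeasurableSpace Ω] (K : Ω → Ω → ℝ≥0∞)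
    (μ : Measure Ω) (x : Ω) : ℝ≥0∞ := ∫⁻ y, K x y ∂μ

/-- The support of a Borel measure. -/
def msupp {Ω : Type*} [TopologicalSpace Ω] [MeasurableSpace Ω] (μ : Measure Ω) : Set Ω :=
  {x | ∀ V : Set Ω, IsOpen V → x ∈ V → 0 < μ V}

/-- `K` is regular. -/
def Regular {Ω : Type*} [TopologicalSpace Ω] [MeasurableSpace Ω] (K : Ω → Ω → ℝ≥0∞) : Prop :=
  ∀ ν : Measure Ω, IsFiniteMeasure ν →
    ContinuousOn (pot K ν) (msupp ν) → (∀ x ∈ msupp ν, pot K ν x ≠ ⊤) →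
    Continuous (pot K ν) ∧ ∀ x, pot K ν x ≠ ⊤

/-- `K` is entirely subharmonic with respect to `σ`: there is `R > 0` such that for each
`y`, the function `x ↦ K x y` is finite on `Ω \ {y}` and satisfies the submean value
inequality with radius `R` there. -/
def EntirelySubharmonic {Ω : Type*} [MetricSpace Ω] [MeasurableSpace Ω]
    (σ : Measure Ω) (K : Ω → Ω → ℝ≥0∞) : Prop :=
  ∃ R > (0 : ℝ), ∀ y : Ω,
    (∀ x, x ≠ y → K x y ≠ ⊤) ∧
    ∀ (x₀ : Ω) (r : ℝ), 0 < r → r < R → closedBall x₀ r ⊆ {y}ᶜ →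
      K x₀ y ≤ (∫⁻ z in closedBall x₀ r, K z y ∂σ) / σ (closedBall x₀ r)

open Filter Topology

/-- The support `msupp` agrees with `Measure.support`. -/
theorem msupp_eq_support {Ω : Type*} [TopologicalSpace Ω] [MeasurableSpace Ω] (μ : Measure Ω) :
    msupp μ = μ.support := by
  ext x
  rw [(nhds_basis_opens x).mem_measureSupport]
  exact ⟨fun h V hV => h V hV.2 hV.1, fun h V hV hx => h V ⟨hx, hV⟩⟩

/-- The potential of a jointly measurable kernel is measurable. -/
theorem measurable_pot {Ω : Type*} [MeasurableSpace Ω] {K : Ω → Ω → ℝ≥0∞}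
    (hK : Measurable (Function.uncurry K)) (μ : Measure Ω) [SFinite μ] :
    Measurable (pot K μ) :=
  hK.lintegral_prod_right'

/-- The potential of a continuous kernel truncated at a finite height is continuous. -/
theorem continuous_pot_min {Ω : Type*} [TopologicalSpace Ω] [FirstCountableTopology Ω]
    [MeasurableSpace Ω] [OpensMeasurableSpace Ω] {K : Ω → Ω → ℝ≥0∞}
    (hK : Continuous (Function.uncurry K)) (μ : Measure Ω) [IsFiniteMeasure μ] (n : ℕ) :
    Continuous (pot (fun x y => min (K x y) n) μ) := by
  rw [continuous_iff_continuousAt]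
  intro x
  refine tendsto_lintegral_filter_of_dominated_convergence (fun _ => (n : ℝ≥0∞)) ?_ ?_ ?_ ?_
  · refine Eventually.of_forall fun x' => ?_
    exact ((hK.comp (by fun_prop : Continuous fun y => (x', y))).min continuous_const).measurable
  · exact Eventually.of_forall fun x' => Eventually.of_forall fun y => min_le_right _ _
  · simp [ENNReal.mul_eq_top]
  · refine Eventually.of_forall fun y => ?_
    exact ((hK.comp (by fun_prop : Continuous fun x' => (x', y))).min continuous_const).tendsto x

/-- The truncated potentials converge to the potential. -/
theorem tendsto_pot_min {Ω : Type*} [MeasurableSpace Ω] {K : Ω → Ω → ℝ≥0∞}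
    (hK : Measurable (Function.uncurry K)) (μ : Measure Ω) (x : Ω) :
    Tendsto (fun n : ℕ => pot (fun x y => min (K x y) n) μ x) atTop (𝓝 (pot K μ x)) := by
  refine lintegral_tendsto_of_tendsto_of_monotone ?_ ?_ ?_
  · exact fun n => ((hK.comp measurable_prodMk_left).min measurable_const).aemeasurable
  · exact Eventually.of_forall fun y m n hmn => min_le_min_left _ (by exact_mod_cast hmn)
  · refine Eventually.of_forall fun y => ?_
    have h := (tendsto_const_nhds (x := K x y)).min ENNReal.tendsto_nat_nhds_top
    simpa using h

/-- A potential is the sum of its truncation and of the potential of the excess. -/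
theorem pot_eq_pot_min_add {Ω : Type*} [MeasurableSpace Ω] {K : Ω → Ω → ℝ≥0∞}
    (hK : Measurable (Function.uncurry K)) (μ : Measure Ω) (n : ℕ) (x : Ω) :
    pot K μ x = pot (fun x y => min (K x y) n) μ x + pot (fun x y => K x y - n) μ x := by
  have hKx : Measurable (K x) := hK.comp measurable_prodMk_left
  unfold pot
  rw [← lintegral_add_left (hKx.min measurable_const)]
  refine lintegral_congr fun y => ?_
  rw [add_comm]
  exact tsub_add_min.symm

theorem pot_mono_measure {Ω : Type*} [MeasurableSpace Ω] (K : Ω → Ω → ℝ≥0∞)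
    {μ ν : Measure Ω} (h : ν ≤ μ) (x : Ω) : pot K ν x ≤ pot K μ x :=
  lintegral_mono' h le_rfl

/-- A potential which is almost everywhere finite becomes continuous on a closed set `F` of almost
full measure once the underlying measure is restricted to `F`. -/
theorem exists_isClosed_continuousOn_pot_restrict {Ω : Type*} [MetricSpace Ω]
    [SecondCountableTopology Ω] [MeasurableSpace Ω] [BorelSpace Ω] {K : Ω → Ω → ℝ≥0∞}
    (hK : Continuous (Function.uncurry K)) (μ : Measure Ω) [IsFiniteMeasure μ]
    {S : Set Ω} (hS : MeasurableSet S) (hμS : μ Sᶜ = 0) (hfin : ∀ x ∈ S, pot K μ x ≠ ⊤)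
    {ε : ℝ} (hε : 0 < ε) :
    ∃ F ⊆ S, IsClosed F ∧ μ Fᶜ ≤ ENNReal.ofReal ε ∧ ContinuousOn (pot K (μ.restrict F)) F := by
  have hKm : Measurable (Function.uncurry K) := hK.measurable
  have hlim : ∀ᵐ x ∂μ, Tendsto (fun n : ℕ => (pot (fun x y => min (K x y) n) μ x).toReal) atTop
      (𝓝 (pot K μ x).toReal) := by
    have hSae : ∀ᵐ x ∂μ, x ∈ S := hμS
    filter_upwards [hSae] with x hx
    exact (ENNReal.tendsto_toReal (hfin x hx)).comp (tendsto_pot_min hKm μ x)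
  obtain ⟨t, htm, htμ, htu⟩ := tendstoUniformlyOn_of_ae_tendsto'
    (fun n => (continuous_pot_min hK μ n).measurable.ennreal_toReal.stronglyMeasurable)
    (measurable_pot hKm μ).ennreal_toReal.stronglyMeasurable hlim (half_pos hε)
  obtain ⟨F, hFsub, hFc, hFμ⟩ := (htm.compl.inter hS).exists_isClosed_sdiff_lt
    (measure_ne_top μ _) (ε := ENNReal.ofReal (ε / 2)) (by simpa using hε)
  have hFS : F ⊆ S := fun x hx => (hFsub hx).2
  refine ⟨F, hFS, hFc, ?_, ?_⟩
  · have hcov : Fᶜ ⊆ (t ∪ Sᶜ) ∪ ((tᶜ ∩ S) \ F) := by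
      intro x hx
      by_cases h1 : x ∈ t <;> by_cases h2 : x ∈ S <;> simp_all
    calc μ Fᶜ ≤ μ (t ∪ Sᶜ) + μ ((tᶜ ∩ S) \ F) := (measure_mono hcov).trans (measure_union_le _ _)
      _ ≤ (μ t + μ Sᶜ) + μ ((tᶜ ∩ S) \ F) := by gcongr; exact measure_union_le _ _
      _ ≤ (ENNReal.ofReal (ε / 2) + 0) + ENNReal.ofReal (ε / 2) := by
        gcongr
        exact hμS.le
      _ = ENNReal.ofReal ε := by
        rw [add_zero, ← ENNReal.ofReal_add (half_pos hε).le (half_pos hε).le, add_halves]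
  · have hfinF : ∀ x ∈ F, pot K (μ.restrict F) x ≠ ⊤ := fun x hx =>
      ne_top_of_le_ne_top (hfin x (hFS hx)) (pot_mono_measure K Measure.restrict_le_self x)
    have hunif : TendstoUniformlyOn
        (fun (n : ℕ) x => (pot (fun x y => min (K x y) n) (μ.restrict F) x).toReal)
        (fun x => (pot K (μ.restrict F) x).toReal) atTop F := by
      rw [Metric.tendstoUniformlyOn_iff] at htu ⊢
      intro δ hδ
      filter_upwards [htu δ hδ] with n hn x hx
      refine lt_of_le_of_lt ?_ (hn x (hFsub hx).1)
      have hdist : ∀ ν : Measure Ω, pot K ν x ≠ ⊤ →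
          dist (pot K ν x).toReal (pot (fun x y => min (K x y) n) ν x).toReal =
            (pot (fun x y => K x y - n) ν x).toReal := by
        intro ν hν
        rw [pot_eq_pot_min_add hKm ν n x] at hν ⊢
        obtain ⟨h1, h2⟩ := ENNReal.add_ne_top.1 hν
        rw [ENNReal.toReal_add h1 h2, Real.dist_eq, add_sub_cancel_left,
          abs_of_nonneg ENNReal.toReal_nonneg]
      rw [hdist _ (hfinF x hx), hdist _ (hfin x (hFS hx))]
      have hfin' := hfin x (hFS hx)
      rw [pot_eq_pot_min_add hKm μ n x] at hfin'
      exact ENNReal.toReal_mono (ENNReal.add_ne_top.1 hfin').2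
        (pot_mono_measure _ Measure.restrict_le_self x)
    have hcontR : ContinuousOn (fun x => (pot K (μ.restrict F) x).toReal) F := by
      refine hunif.continuousOn (Frequently.of_forall fun n => ?_)
      refine ENNReal.continuousOn_toReal.comp
        (continuous_pot_min hK (μ.restrict F) n).continuousOn fun x hx => ?_
      refine ne_top_of_le_ne_top (hfinF x hx) ?_
      rw [pot_eq_pot_min_add hKm _ n x]
      exact le_self_add
    refine (ENNReal.continuous_ofReal.comp_continuousOn hcontR).congr fun x hx => ?_
    exact (ENNReal.ofReal_toReal (hfinF x hx)).symm

/-- The potential of a measure inherits the submean value inequality of the kernel on closed balls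
which do not meet the support of the measure. -/
theorem mul_pot_le_setLIntegral_pot {Ω : Type*} [MetricSpace Ω] [SecondCountableTopology Ω]
    [MeasurableSpace Ω] [BorelSpace Ω] {σ : Measure Ω} [IsFiniteMeasure σ]
    {K : Ω → Ω → ℝ≥0∞} (hK : Measurable (Function.uncurry K))
    (ν : Measure Ω) [IsFiniteMeasure ν] {x₀ : Ω} {r : ℝ} (hσ : σ (closedBall x₀ r) ≠ 0)
    (hmean : ∀ y ∈ ν.support,
      K x₀ y ≤ (∫⁻ z in closedBall x₀ r, K z y ∂σ) / σ (closedBall x₀ r)) :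
    pot K ν x₀ * σ (closedBall x₀ r) ≤ ∫⁻ z in closedBall x₀ r, pot K ν z ∂σ := by
  have hswap : ∫⁻ z in closedBall x₀ r, pot K ν z ∂σ =
      ∫⁻ y, ∫⁻ z in closedBall x₀ r, K z y ∂σ ∂ν :=
    lintegral_lintegral_swap hK.aemeasurable
  have hKx : Measurable (K x₀) := hK.comp measurable_prodMk_left
  rw [hswap, pot, ← lintegral_mul_const _ hKx]
  refine lintegral_mono_ae ?_
  filter_upwards [Measure.support_mem_ae (μ := ν)] with y hy
  exact (ENNReal.le_div_iff_mul_le (Or.inl hσ) (Or.inl (measure_ne_top σ _))).1 (hmean y hy)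

/-- The maximum principle for measures with a continuous finite potential. -/
theorem pot_le_of_continuous {Ω : Type*} [MetricSpace Ω] [CompactSpace Ω] [ConnectedSpace Ω]
    [MeasurableSpace Ω] [BorelSpace Ω] {σ : Measure Ω} [IsFiniteMeasure σ]
    [σ.IsOpenPosMeasure] {K : Ω → Ω → ℝ≥0∞} (hK : Measurable (Function.uncurry K))
    (hsubh : EntirelySubharmonic σ K) (ν : Measure Ω) [IsFiniteMeasure ν]
    (hcont : Continuous (pot K ν)) (hfin : ∀ x, pot K ν x ≠ ⊤) {M : ℝ≥0∞}
    (hbound : ∀ x ∈ ν.support, pot K ν x ≤ M) (x : Ω) : pot K ν x ≤ M := by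
  obtain ⟨R, hR, hsub⟩ := hsubh
  obtain ⟨xm, -, hmax⟩ := isCompact_univ.exists_isMaxOn univ_nonempty hcont.continuousOn
  have hle : ∀ z, pot K ν z ≤ pot K ν xm := fun z => hmax (mem_univ z)
  by_contra! hx
  have hMm : M < pot K ν xm := hx.trans_le (hle x)
  have hclosed : IsClosed {z | pot K ν z = pot K ν xm} := isClosed_eq hcont continuous_const
  have hopen : IsOpen {z | pot K ν z = pot K ν xm} := by
    rw [isOpen_iff_mem_nhds]
    intro x₀ (hx₀ : pot K ν x₀ = pot K ν xm)
    have hx₀S : x₀ ∈ ν.supportᶜ := fun h => (hbound x₀ h).not_gt (hx₀ ▸ hMm)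
    obtain ⟨s, hs, hsS⟩ := Metric.nhds_basis_closedBall.mem_iff.1
      (Measure.isOpen_compl_support.mem_nhds hx₀S)
    obtain ⟨r, hr, hrm⟩ := exists_between (lt_min hs hR)
    have hrs : closedBall x₀ r ⊆ ν.supportᶜ :=
      (closedBall_subset_closedBall (hrm.trans_le (min_le_left _ _)).le).trans hsS
    have hpos : σ (closedBall x₀ r) ≠ 0 := (measure_closedBall_pos σ x₀ hr).ne'
    have hmean := mul_pot_le_setLIntegral_pot (σ := σ) hK ν hpos fun y hy =>
      (hsub y).2 x₀ r hr (hrm.trans_le (min_le_right _ _))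
        fun z hz hzy => hrs hz (mem_singleton_iff.1 hzy ▸ hy)
    have hae : pot K ν =ᵐ[σ.restrict (closedBall x₀ r)] fun _ => pot K ν xm := by
      refine ae_eq_of_ae_le_of_lintegral_le (Eventually.of_forall hle) ?_ aemeasurable_const ?_
      · refine ne_top_of_le_ne_top ?_ (lintegral_mono hle)
        simpa using ENNReal.mul_ne_top (hfin xm) (measure_ne_top σ _)
      · simpa [hx₀] using hmean
    have heq := Measure.eqOn_open_of_ae_eq
      (ae_restrict_of_ae_restrict_of_subset ball_subset_closedBall hae) isOpen_ball
      hcont.continuousOn continuousOn_const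
    exact mem_of_superset (ball_mem_nhds x₀ hr) heq
  have huniv := IsClopen.eq_univ ⟨hclosed, hopen⟩ ⟨xm, rfl⟩
  have hne : ν.support.Nonempty := by
    refine Measure.nonempty_support fun h0 => ?_
    simp [h0, pot] at hx
  obtain ⟨y, hy⟩ := hne
  have hyeq : pot K ν y = pot K ν xm := huniv.ge (mem_univ y)
  exact (hbound y hy).not_gt (hyeq ▸ hMm)

/-- First Maximum Principle: for a regular, entirely subharmonic, symmetric
extended-continuous kernel on a compact connected metric space, a bound for the potential
of a finite measure on its support holds on the whole space. -/
theorem first_maximum_principle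
    {Ω : Type*} [MetricSpace Ω] [CompactSpace Ω] [ConnectedSpace Ω]
    [MeasurableSpace Ω] [BorelSpace Ω]
    (σ : Measure Ω) [IsProbabilityMeasure σ]
    (hσfull : ∀ (x : Ω) (r : ℝ), 0 < r → 0 < σ (closedBall x r))
    (K : Ω → Ω → ℝ≥0∞) (hsym : ∀ x y, K x y = K y x)
    (hKcont : Continuous (Function.uncurry K))
    (hreg : Regular K) (hsubh : EntirelySubharmonic σ K)
    (μ : Measure Ω) [IsFiniteMeasure μ] (M : ℝ≥0∞)
    (hbound : ∀ x ∈ msupp μ, pot K μ x ≤ M) :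
    ∀ x : Ω, pot K μ x ≤ M := by
  intro x
  rcases eq_or_ne M ⊤ with rfl | hM
  · exact le_top
  have : σ.IsOpenPosMeasure := by
    refine ⟨fun U hU ⟨y, hy⟩ hU0 => ?_⟩
    obtain ⟨r, hr, hrU⟩ := Metric.nhds_basis_closedBall.mem_iff.1 (hU.mem_nhds hy)
    exact (hσfull y r hr).ne' (measure_mono_null hrU hU0)
  have hKm : Measurable (Function.uncurry K) := hKcont.measurable
  rw [msupp_eq_support] at hbound
  refine le_of_tendsto' (tendsto_pot_min hKm μ x) fun n => ?_
  refine ENNReal.le_of_forall_pos_le_add fun ε hε _ => ?_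
  have hε' : (0 : ℝ) < ε / (n + 1) := by positivity
  obtain ⟨F, hFS, hFc, hFμ, hFcont⟩ := exists_isClosed_continuousOn_pot_restrict hKcont μ
    Measure.isClosed_support.measurableSet Measure.measure_compl_support
    (fun x hx => ne_top_of_le_ne_top hM (hbound x hx)) hε'
  have hsupp : (μ.restrict F).support ⊆ F :=
    Measure.support_subset_of_isClosed hFc (ae_restrict_mem hFc.measurableSet)
  have hboundF : ∀ z ∈ (μ.restrict F).support, pot K (μ.restrict F) z ≤ M := fun z hz =>
    (pot_mono_measure K Measure.restrict_le_self z).trans (hbound z (hFS (hsupp hz)))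
  obtain ⟨hcont, hfin⟩ := hreg (μ.restrict F) inferInstance
    (by rw [msupp_eq_support]; exact hFcont.mono hsupp)
    (by rw [msupp_eq_support]; exact fun z hz => ne_top_of_le_ne_top hM (hboundF z hz))
  have hF := pot_le_of_continuous hKm hsubh (μ.restrict F) hcont hfin hboundF x
  calc pot (fun x y => min (K x y) n) μ x
      = ∫⁻ y in F, min (K x y) n ∂μ + ∫⁻ y in Fᶜ, min (K x y) n ∂μ :=
        (lintegral_add_compl _ hFc.measurableSet).symm
    _ ≤ pot K (μ.restrict F) x + ∫⁻ _ in Fᶜ, (n : ℝ≥0∞) ∂μ :=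
        add_le_add (lintegral_mono fun y => min_le_left _ _)
          (lintegral_mono fun y => min_le_right _ _)
    _ ≤ M + n * ENNReal.ofReal (ε / (n + 1)) := by
        rw [setLIntegral_const]
        gcongr
    _ ≤ M + ε := by
        gcongr
        rw [← ENNReal.ofReal_natCast, ← ENNReal.ofReal_mul (Nat.cast_nonneg n),
          ← ENNReal.ofReal_coe_nnreal (p := ε)]
        refine ENNReal.ofReal_le_ofReal ?_
        rw [mul_div_assoc', div_le_iff₀ (by positivity)]
        nlinarith [ε.coe_nonneg]
end

section
/- Let (Ω,ρ) be a compact metric space and K : Ω × Ω → [0,∞] symmetric and lower semi-continuous (in particular, extended-continuous). Then there exists a Borel probability measure μ on Ω minimizing the energy I_K(μ) = ∫∫ K(x,y) dμ(x) dμ(y) over all Borel probability measures on Ω. -/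
open MeasureTheory Metric Set ENNReal

/-- The energy of a measure `μ` with respect to a kernel `K`. -/
noncomputable def energy {Ω : Type*} [MeasurableSpace Ω] (K : Ω → Ω → ℝ≥0∞)
    (μ : Measure Ω) : ℝ≥0∞ := ∫⁻ x, ∫⁻ y, K x y ∂μ ∂μ

/-- Integration of a finite-valued lower semicontinuous function is lower semicontinuous for the
weak topology on probability measures. -/
lemma lowerSemicontinuous_lintegral_of_ne_top {X : Type*} [TopologicalSpace X]
    [TopologicalSpace.PseudoMetrizableSpace X] [SecondCountableTopology X]
    [MeasurableSpace X] [BorelSpace X]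
    {f : X → ℝ≥0∞} (hf : LowerSemicontinuous f) (hfin : ∀ x, f x ≠ ∞) :
    LowerSemicontinuous fun μ : ProbabilityMeasure X ↦ ∫⁻ x, f x ∂(μ : Measure X) := by
  rw [lowerSemicontinuous_iff_le_liminf]
  intro μ
  have layercake (ν : ProbabilityMeasure X) : ∫⁻ x, f x ∂(ν : Measure X) =
      ∫⁻ t in Ioi (0 : ℝ), (ν : Measure X) {x | ENNReal.ofReal t < f x} := by
    calc ∫⁻ x, f x ∂(ν : Measure X)
        = ∫⁻ x, ENNReal.ofReal (f x).toReal ∂(ν : Measure X) := by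
          simp only [ENNReal.ofReal_toReal (hfin _)]
      _ = ∫⁻ t in Ioi (0 : ℝ), (ν : Measure X) {x | t < (f x).toReal} :=
          lintegral_eq_lintegral_meas_lt _ (.of_forall fun x ↦ ENNReal.toReal_nonneg)
            hf.measurable.ennreal_toReal.aemeasurable
      _ = ∫⁻ t in Ioi (0 : ℝ), (ν : Measure X) {x | ENNReal.ofReal t < f x} := by
          refine setLIntegral_congr_fun measurableSet_Ioi fun t ht ↦ ?_
          simp only [ENNReal.ofReal_lt_iff_lt_toReal (le_of_lt ht) (hfin _)]
  simp only [layercake]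
  refine (lintegral_mono fun t ↦ ?_).trans (lintegral_liminf_le fun ν ↦ ?_)
  · exact ProbabilityMeasure.le_liminf_measure_open_of_tendsto Filter.tendsto_id
      (hf.isOpen_preimage (ENNReal.ofReal t))
  · exact Antitone.measurable fun s t hst ↦
      measure_mono fun x hx ↦ (ENNReal.ofReal_le_ofReal hst).trans_lt hx

/-- Integration of a lower semicontinuous function with values in `[0, ∞]` is lower semicontinuous
for the weak topology on probability measures. -/
lemma lowerSemicontinuous_lintegral {X : Type*} [TopologicalSpace X]
    [TopologicalSpace.PseudoMetrizableSpace X] [SecondCountableTopology X]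
    [MeasurableSpace X] [BorelSpace X] {f : X → ℝ≥0∞} (hf : LowerSemicontinuous f) :
    LowerSemicontinuous fun μ : ProbabilityMeasure X ↦ ∫⁻ x, f x ∂(μ : Measure X) := by
  have htrunc (n : ℕ) : LowerSemicontinuous fun x ↦ f x ⊓ (n : ℝ≥0∞) :=
    hf.inf lowerSemicontinuous_const
  have hsup (x : X) : f x = ⨆ n : ℕ, f x ⊓ (n : ℝ≥0∞) := by
    rw [← inf_iSup_eq, ENNReal.iSup_natCast, inf_top_eq]
  have hint (μ : ProbabilityMeasure X) : ∫⁻ x, f x ∂(μ : Measure X) =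
      ⨆ n : ℕ, ∫⁻ x, f x ⊓ (n : ℝ≥0∞) ∂(μ : Measure X) := by
    rw [← lintegral_iSup (fun n ↦ (htrunc n).measurable)
      fun m n hmn x ↦ inf_le_inf_left _ (Nat.cast_le.2 hmn)]
    exact lintegral_congr hsup
  simp only [hint]
  exact lowerSemicontinuous_iSup fun n ↦ lowerSemicontinuous_lintegral_of_ne_top (htrunc n)
    fun x ↦ (inf_le_right.trans_lt (ENNReal.natCast_lt_top n)).ne

/-- The energy of a lower semicontinuous kernel is lower semicontinuous for the weak topology on
probability measures. -/
lemma lowerSemicontinuous_energy {X : Type*} [TopologicalSpace X]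
    [TopologicalSpace.PseudoMetrizableSpace X] [SecondCountableTopology X]
    [MeasurableSpace X] [BorelSpace X] {K : X → X → ℝ≥0∞}
    (hK : LowerSemicontinuous (Function.uncurry K)) :
    LowerSemicontinuous fun μ : ProbabilityMeasure X ↦ energy K (μ : Measure X) := by
  have henergy (μ : ProbabilityMeasure X) : energy K (μ : Measure X) =
      ∫⁻ z, Function.uncurry K z ∂(μ.prod μ : Measure (X × X)) :=
    (lintegral_prod _ hK.measurable.aemeasurable).symm
  simp only [henergy]
  exact (lowerSemicontinuous_lintegral hK).comp
    (ProbabilityMeasure.continuous_prod.comp (continuous_id.prodMk continuous_id))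

/-- On a (nonempty) compact metric space, for a symmetric lower semicontinuous kernel
`K : Ω × Ω → [0,∞]` there exists a Borel probability measure minimizing the energy. -/
theorem exists_energy_minimizer
    {Ω : Type*} [MetricSpace Ω] [CompactSpace Ω] [Nonempty Ω]
    [MeasurableSpace Ω] [BorelSpace Ω]
    (K : Ω → Ω → ℝ≥0∞) (hsym : ∀ x y, K x y = K y x)
    (hKlsc : LowerSemicontinuous (Function.uncurry K)) :
    ∃ μ : Measure Ω, IsProbabilityMeasure μ ∧
      ∀ ν : Measure Ω, IsProbabilityMeasure ν → energy K μ ≤ energy K ν := by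
  have : Nonempty (ProbabilityMeasure Ω) :=
    ⟨⟨Measure.dirac (Classical.arbitrary Ω), inferInstance⟩⟩
  obtain ⟨μ, -, hμ⟩ := LowerSemicontinuousOn.exists_isMinOn univ_nonempty isCompact_univ
    ((lowerSemicontinuous_energy hKlsc).lowerSemicontinuousOn univ)
  exact ⟨μ, μ.2, fun ν hν ↦ hμ (mem_univ (⟨ν, hν⟩ : ProbabilityMeasure Ω))⟩
end

section
/- (Ninomiya) Let Ω be a compact metric space and K : Ω × Ω → [0,∞] a symmetric extended-continuous kernel satisfying the first maximum principle (for every finite unsigned Borel measure μ, sup over Ω of U_K^μ equals sup over supp(μ) of U_K^μ). Then K is positive definite: I_K(μ) ≥ 0 for every finite signed Borel measure μ for which I_K(μ) is well-defined. -/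
open MeasureTheory Metric Set ENNReal

/-- The mutual energy of two unsigned measures. -/
noncomputable def mutualEnergy {Ω : Type*} [MeasurableSpace Ω] (K : Ω → Ω → ℝ≥0∞)
    (a b : Measure Ω) : ℝ≥0∞ := ∫⁻ x, ∫⁻ y, K x y ∂b ∂a

/-- The energy of a signed measure `a - b` is well-defined when not of the form `∞ - ∞`. -/
def WellDef {Ω : Type*} [MeasurableSpace Ω] (K : Ω → Ω → ℝ≥0∞) (a b : Measure Ω) : Prop :=
  energy K a + energy K b ≠ ⊤ ∨ mutualEnergy K a b ≠ ⊤

/-- The energy of the signed measure `a - b`, as an extended real number. -/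
noncomputable def signedEnergy {Ω : Type*} [MeasurableSpace Ω] (K : Ω → Ω → ℝ≥0∞)
    (a b : Measure Ω) : EReal :=
  ((energy K a + energy K b : ℝ≥0∞) : EReal) - ((2 * mutualEnergy K a b : ℝ≥0∞) : EReal)

open Filter Topology
open scoped NNReal

/-- A nonnegative integral is the limit of the integrals of the truncations. -/
theorem lintegral_eq_iSup_min {X : Type*} [MeasurableSpace X] (μ : Measure X) {f : X → ℝ≥0∞}
    (hf : Measurable f) : ∫⁻ x, f x ∂μ = ⨆ n : ℕ, ∫⁻ x, min (f x) n ∂μ := by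
  rw [← lintegral_iSup (fun n => hf.min measurable_const)]
  · refine lintegral_congr fun x => le_antisymm ?_ (iSup_le fun n => min_le_left _ _)
    rcases eq_or_ne (f x) ⊤ with h | h
    · simp [h, ENNReal.iSup_natCast]
    · obtain ⟨n, hn⟩ := ENNReal.exists_nat_gt h
      exact le_iSup_of_le n (by simp [hn.le])
  · intro m n hmn x
    exact min_le_min le_rfl (by exact_mod_cast hmn)

/-- Integration of a continuous `ℝ≥0∞`-valued function is lower semicontinuous for the topology
of weak convergence. -/
theorem lowerSemicontinuous_probabilityMeasure_lintegral {X : Type*} [TopologicalSpace X]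
    [MeasurableSpace X] [OpensMeasurableSpace X] {f : X → ℝ≥0∞} (hf : Continuous f) :
    LowerSemicontinuous fun μ : ProbabilityMeasure X => ∫⁻ x, f x ∂(μ : Measure X) := by
  simp_rw [lintegral_eq_iSup_min _ hf.measurable]
  refine lowerSemicontinuous_iSup fun n => Continuous.lowerSemicontinuous ?_
  have hlt : ∀ x, min (f x) n ≠ ⊤ := fun x => ne_top_of_le_ne_top (by simp) (min_le_right _ _)
  have hle : ∀ x, (min (f x) n).toNNReal ≤ n := fun x => by
    simpa using ENNReal.toNNReal_mono (by simp) (min_le_right (f x) n)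
  have hc : Continuous fun x => (min (f x) n).toNNReal :=
    ENNReal.continuousOn_toNNReal.comp_continuous (hf.min continuous_const) hlt
  let g : BoundedContinuousFunction X ℝ≥0 :=
    BoundedContinuousFunction.mkOfBound ⟨_, hc⟩ (n + n) fun x y => by
      refine (NNReal.dist_eq _ _).trans_le ?_
      have hx : ((min (f x) n).toNNReal : ℝ) ≤ n := by exact_mod_cast hle x
      have hy : ((min (f y) n).toNNReal : ℝ) ≤ n := by exact_mod_cast hle y
      have hx' := (min (f x) n).toNNReal.coe_nonneg
      have hy' := (min (f y) n).toNNReal.coe_nonneg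
      rw [abs_le]
      simp only [ContinuousMap.coe_mk]
      constructor <;> linarith
  have hg : ∀ x, min (f x) n = g x := fun x => (ENNReal.coe_toNNReal (hlt x)).symm
  simp_rw [hg]
  exact ProbabilityMeasure.continuous_iff_forall_continuous_lintegral.1 continuous_id g

theorem energy_smul {X : Type*} [MeasurableSpace X] {W : X → X → ℝ≥0∞}
    {c : ℝ≥0∞} (hc : c ≠ ⊤) (ρ : Measure X) :
    energy W (c • ρ) = c ^ 2 * energy W ρ := by
  simp only [energy, lintegral_smul_measure, smul_eq_mul]
  rw [lintegral_const_mul' _ _ hc, sq, mul_assoc]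

/-- Homogeneous form of the minimality of the energy of `π`. -/
theorem energy_mul_sq_le {X : Type*} [MeasurableSpace X] {W : X → X → ℝ≥0∞}
    {π : ProbabilityMeasure X}
    (hπ : ∀ ρ : ProbabilityMeasure X, energy W π ≤ energy W ρ) (ρ : Measure X)
    [IsFiniteMeasure ρ] : energy W π * ρ univ ^ 2 ≤ energy W ρ := by
  rcases eq_or_ne ρ 0 with rfl | h0
  · simp
  have : NeZero ρ := ⟨h0⟩
  have h := hπ ⟨(ρ univ)⁻¹ • ρ, inferInstance⟩
  rw [ProbabilityMeasure.coe_mk, energy_smul (by simp [h0])] at h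
  calc energy W π * ρ univ ^ 2 ≤ ((ρ univ)⁻¹ ^ 2 * energy W ρ) * ρ univ ^ 2 := by gcongr
    _ = ((ρ univ)⁻¹ * ρ univ) ^ 2 * energy W ρ := by ring
    _ = energy W ρ := by
      rw [ENNReal.inv_mul_cancel (by simpa using h0) (measure_ne_top _ _)]; simp

section Energy

variable {X : Type*} [TopologicalSpace X] [SecondCountableTopology X]
  [MeasurableSpace X] [BorelSpace X] {W : X → X → ℝ≥0∞}

theorem measurable_pot_s14 (hW : Continuous (Function.uncurry W)) (μ : Measure X) [SFinite μ] :
    Measurable (pot W μ) :=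
  hW.measurable.lintegral_prod_right

theorem lintegral_pot_comm (hsym : ∀ x y, W x y = W y x) (hW : Continuous (Function.uncurry W))
    (μ ν : Measure X) [SFinite μ] [SFinite ν] :
    ∫⁻ x, pot W μ x ∂ν = ∫⁻ x, pot W ν x ∂μ := by
  unfold pot
  rw [lintegral_lintegral_swap hW.measurable.aemeasurable]
  exact lintegral_congr fun x => lintegral_congr fun y => hsym y x

theorem lowerSemicontinuous_pot [T2Space X] [TopologicalSpace.PseudoMetrizableSpace X]
    (hW : Continuous (Function.uncurry W)) (π : ProbabilityMeasure X) :
    LowerSemicontinuous (pot W (π : Measure X)) := by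
  have h := LowerSemicontinuous.comp (lowerSemicontinuous_probabilityMeasure_lintegral hW)
    (ProbabilityMeasure.continuous_prod.comp
      (continuous_diracProba.prodMk (continuous_const (y := π))))
  convert h using 1
  ext x
  change pot W π x = ∫⁻ z, Function.uncurry W z ∂((Measure.dirac x).prod (π : Measure X))
  rw [lintegral_prod _ hW.measurable.aemeasurable]
  exact (lintegral_dirac' x (measurable_pot_s14 hW _)).symm

/-- A continuous kernel on a compact space has a probability measure of minimal energy. -/
theorem exists_energy_minimizer_s14 [CompactSpace X] [T2Space X]
    [TopologicalSpace.PseudoMetrizableSpace X] [Nonempty X]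
    (hW : Continuous (Function.uncurry W)) :
    ∃ π : ProbabilityMeasure X, ∀ ρ : ProbabilityMeasure X, energy W π ≤ energy W ρ := by
  have h := LowerSemicontinuous.comp (lowerSemicontinuous_probabilityMeasure_lintegral hW)
    (ProbabilityMeasure.continuous_prod.comp
      (continuous_id.prodMk (continuous_id (X := ProbabilityMeasure X))))
  have hne : (univ : Set (ProbabilityMeasure X)).Nonempty :=
    ⟨diracProba (Classical.arbitrary X), mem_univ _⟩
  obtain ⟨π, -, hπ⟩ := (h.lowerSemicontinuousOn univ).exists_isMinOn hne isCompact_univ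
  refine ⟨π, fun ρ => ?_⟩
  have := hπ (mem_univ ρ)
  simpa [energy, lintegral_prod _ hW.measurable.aemeasurable] using this

theorem energy_add_smul (hsym : ∀ x y, W x y = W y x) (hW : Continuous (Function.uncurry W))
    (μ η : Measure X) [IsFiniteMeasure μ] [IsFiniteMeasure η] (t : ℝ≥0) :
    energy W (μ + t • η) =
      energy W μ + t * (2 * ∫⁻ x, pot W μ x ∂η + t * energy W η) := by
  have hm := measurable_pot_s14 hW
  have key : ∀ x, pot W (μ + t • η) x = pot W μ x + t * pot W η x := fun x => by
    simp only [pot, lintegral_add_measure, lintegral_smul_measure]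
    rfl
  change ∫⁻ x, pot W (μ + t • η) x ∂(μ + t • η) = ∫⁻ x, pot W μ x ∂μ +
    t * (2 * ∫⁻ x, pot W μ x ∂η + t * ∫⁻ x, pot W η x ∂η)
  simp_rw [key, lintegral_add_measure, lintegral_smul_measure]
  rw [lintegral_add_left (hm μ), lintegral_add_left (hm μ), lintegral_const_mul _ (hm η),
    lintegral_const_mul _ (hm η), lintegral_pot_comm hsym hW η μ, ENNReal.smul_def, smul_eq_mul]
  ring

/-- First variation at a minimizer of the energy. -/
theorem energy_mul_le_lintegral_pot (hsym : ∀ x y, W x y = W y x)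
    (hW : Continuous (Function.uncurry W)) {π : ProbabilityMeasure X}
    (hπ : ∀ ρ : ProbabilityMeasure X, energy W π ≤ energy W ρ) (hfin : energy W π ≠ ⊤)
    (η : Measure X) [IsFiniteMeasure η] (hη : energy W η ≠ ⊤) :
    energy W π * η univ ≤ ∫⁻ x, pot W π x ∂η := by
  have hvar : ∀ t : ℝ≥0, 0 < t →
      2 * (energy W π * η univ) ≤ 2 * ∫⁻ x, pot W π x ∂η + t * energy W η := fun t ht => by
    have h := energy_mul_sq_le hπ ((π : Measure X) + t • η)
    rw [energy_add_smul hsym hW] at h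
    have h' : energy W π + t * (2 * (energy W π * η univ)) ≤
        energy W π * ((π : Measure X) + t • η) univ ^ 2 := by
      have : ((π : Measure X) + t • η) univ = 1 + t * η univ := by
        rw [Measure.add_apply, measure_univ]; rfl
      rw [this]
      calc _ ≤ energy W π + t * (2 * (energy W π * η univ)) + energy W π * (t * η univ) ^ 2 :=
            le_self_add
        _ = _ := by ring
    have h2 := (ENNReal.add_le_add_iff_left hfin).1 (h'.trans h)
    exact (ENNReal.mul_le_mul_iff_right (by simpa using ht.ne') (by simp)).1 h2
  have hlim : Tendsto (fun t : ℝ≥0 => 2 * ∫⁻ x, pot W π x ∂η + t * energy W η) (𝓝[>] 0)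
      (𝓝 (2 * ∫⁻ x, pot W π x ∂η + (0 : ℝ≥0) * energy W η)) := by
    refine Tendsto.mono_left ?_ nhdsWithin_le_nhds
    exact tendsto_const_nhds.add (ENNReal.Tendsto.mul_const
      (ENNReal.continuous_coe.tendsto 0) (Or.inr hη))
  have h := ge_of_tendsto hlim (eventually_nhdsWithin_of_forall hvar)
  simp only [ENNReal.coe_zero, zero_mul, add_zero] at h
  exact (ENNReal.mul_le_mul_iff_right two_ne_zero (by simp)).1 h

/-- **Frostman's theorem**: the potential of a minimizer of the energy is at most the minimal
energy on the support of the minimizer. -/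
theorem pot_le_energy_of_mem_msupp [T2Space X] [TopologicalSpace.PseudoMetrizableSpace X]
    (hsym : ∀ x y, W x y = W y x)
    (hW : Continuous (Function.uncurry W)) {π : ProbabilityMeasure X}
    (hπ : ∀ ρ : ProbabilityMeasure X, energy W π ≤ energy W ρ) (hfin : energy W π ≠ ⊤)
    {x : X} (hx : x ∈ msupp (π : Measure X)) : pot W π x ≤ energy W π := by
  by_contra! hlt
  obtain ⟨c, hec, hcx⟩ := exists_between hlt
  set E := pot W (π : Measure X) ⁻¹' Ioi c
  have hE : IsOpen E := (lowerSemicontinuous_pot hW π).isOpen_preimage c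
  have hEpos : 0 < (π : Measure X) E := hx E hE hcx
  have hcompl : energy W π * (π : Measure X) Eᶜ ≤ ∫⁻ x in Eᶜ, pot W π x ∂π := by
    have h := energy_mul_le_lintegral_pot hsym hW hπ hfin ((π : Measure X).restrict Eᶜ)
      (ne_top_of_le_ne_top hfin (lintegral_mono' Measure.restrict_le_self fun x =>
        lintegral_mono' Measure.restrict_le_self le_rfl))
    simpa using h
  have hcE : c * (π : Measure X) E ≤ ∫⁻ x in E, pot W π x ∂π := by
    rw [← setLIntegral_const]
    exact setLIntegral_mono (measurable_pot_s14 hW _) fun y hy => le_of_lt hy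
  have hsum : c * (π : Measure X) E + energy W π * (π : Measure X) Eᶜ ≤
      energy W π * (π : Measure X) E + energy W π * (π : Measure X) Eᶜ := by
    calc _ ≤ ∫⁻ x in E, pot W π x ∂π + ∫⁻ x in Eᶜ, pot W π x ∂π := add_le_add hcE hcompl
      _ = energy W π := lintegral_add_compl _ hE.measurableSet
      _ = _ := by rw [← mul_add, measure_add_measure_compl hE.measurableSet]; simp
  have hle := (ENNReal.add_le_add_iff_right
    (ENNReal.mul_ne_top hfin (measure_ne_top _ _))).1 hsum
  exact hec.not_ge ((ENNReal.mul_le_mul_iff_left hEpos.ne' (measure_ne_top _ _)).1 hle)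

end Energy

section Doubling

variable {Ω : Type*}

/-- The kernel on `Ω × Bool` equal to `K + C` on the diagonal blocks and to the truncated
difference `C - K` on the other ones. -/
noncomputable def doubledKernel (K : Ω → Ω → ℝ≥0∞) (C : ℝ≥0∞) (p q : Ω × Bool) : ℝ≥0∞ :=
  if p.2 = q.2 then K p.1 q.1 + C else C - K p.1 q.1

theorem doubledKernel_symm {K : Ω → Ω → ℝ≥0∞} (hsym : ∀ x y, K x y = K y x) (C : ℝ≥0∞)
    (p q : Ω × Bool) : doubledKernel K C p q = doubledKernel K C q p := by
  simp only [doubledKernel, hsym p.1 q.1, eq_comm (a := p.2)]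

theorem continuous_doubledKernel [TopologicalSpace Ω] {K : Ω → Ω → ℝ≥0∞}
    (hK : Continuous (Function.uncurry K)) {C : ℝ≥0∞} (hC : C ≠ ⊤) :
    Continuous (Function.uncurry (doubledKernel K C)) := by
  have hK' : Continuous fun z : (Ω × Bool) × (Ω × Bool) => K z.1.1 z.2.1 :=
    hK.comp (by fun_prop : Continuous fun z : (Ω × Bool) × (Ω × Bool) => (z.1.1, z.2.1))
  have hs : IsClopen {z : (Ω × Bool) × (Ω × Bool) | z.1.2 = z.2.2} :=
    (isClopen_discrete {w : Bool × Bool | w.1 = w.2}).preimage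
      (by fun_prop : Continuous fun z : (Ω × Bool) × (Ω × Bool) => (z.1.2, z.2.2))
  refine Continuous.if ?_ (hK'.add continuous_const) ((ENNReal.continuous_sub_left hC).comp hK')
  intro z hz
  rw [hs.frontier_eq] at hz
  exact hz.elim

variable [MeasurableSpace Ω]

/-- The measure on `Ω × Bool` with components `a` and `b`. -/
noncomputable def doubledMeasure (a b : Measure Ω) : Measure (Ω × Bool) :=
  a.map (fun x => (x, true)) + b.map (fun x => (x, false))

theorem lintegral_doubledMeasure (a b : Measure Ω) {f : Ω × Bool → ℝ≥0∞} (hf : Measurable f) :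
    ∫⁻ p, f p ∂(doubledMeasure a b) = ∫⁻ x, f (x, true) ∂a + ∫⁻ x, f (x, false) ∂b := by
  rw [doubledMeasure, lintegral_add_measure, lintegral_map hf (by fun_prop),
    lintegral_map hf (by fun_prop)]

theorem doubledMeasure_univ (a b : Measure Ω) : doubledMeasure a b univ = a univ + b univ := by
  rw [doubledMeasure, Measure.add_apply, Measure.map_apply (by fun_prop) .univ,
    Measure.map_apply (by fun_prop) .univ]
  simp

instance (a b : Measure Ω) [IsFiniteMeasure a] [IsFiniteMeasure b] :
    IsFiniteMeasure (doubledMeasure a b) :=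
  ⟨by rw [doubledMeasure_univ]; finiteness⟩

/-- Every finite measure on `Ω × Bool` is determined by its two components. -/
theorem exists_eq_doubledMeasure (π : Measure (Ω × Bool)) [IsFiniteMeasure π] :
    ∃ a b : Measure Ω, IsFiniteMeasure a ∧ IsFiniteMeasure b ∧ π = doubledMeasure a b := by
  have hS : ∀ i, MeasurableSet {p : Ω × Bool | p.2 = i} := fun i =>
    measurable_snd (measurableSet_singleton i)
  refine ⟨(π.restrict {p | p.2 = true}).map Prod.fst, (π.restrict {p | p.2 = false}).map Prod.fst,
    inferInstance, inferInstance, ?_⟩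
  ext s hs
  have hm : ∀ i, MeasurableSet ((fun x : Ω => (x, i)) ⁻¹' s) := fun i =>
    (by fun_prop : Measurable fun x : Ω => (x, i)) hs
  rw [doubledMeasure, Measure.add_apply, Measure.map_apply (by fun_prop) hs,
    Measure.map_apply (by fun_prop) hs, Measure.map_apply measurable_fst (hm _),
    Measure.map_apply measurable_fst (hm _), Measure.restrict_apply (measurable_fst (hm _)),
    Measure.restrict_apply (measurable_fst (hm _)), ← measure_union _
      ((measurable_fst (hm _)).inter (hS _))]
  · congr 1
    ext ⟨x, i⟩
    cases i <;> simp
  · rw [Set.disjoint_left]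
    rintro ⟨x, i⟩ ⟨-, h⟩ ⟨-, h'⟩
    simp_all

theorem mem_msupp_doubledMeasure_left [TopologicalSpace Ω] [BorelSpace Ω]
    [SecondCountableTopology Ω] {a b : Measure Ω} {x : Ω} (hx : x ∈ msupp a) :
    (x, true) ∈ msupp (doubledMeasure a b) := fun V hV hxV => by
  rw [doubledMeasure, Measure.add_apply, Measure.map_apply (by fun_prop) hV.measurableSet]
  exact (hx _ (hV.preimage (by fun_prop : Continuous fun y : Ω => (y, true))) hxV).trans_le
    le_self_add

theorem mem_msupp_doubledMeasure_right [TopologicalSpace Ω] [BorelSpace Ω]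
    [SecondCountableTopology Ω] {a b : Measure Ω} {x : Ω} (hx : x ∈ msupp b) :
    (x, false) ∈ msupp (doubledMeasure a b) := fun V hV hxV => by
  rw [doubledMeasure, Measure.add_apply, add_comm,
    Measure.map_apply (by fun_prop) hV.measurableSet]
  exact (hx _ (hV.preimage (by fun_prop : Continuous fun y : Ω => (y, false))) hxV).trans_le
    le_self_add

variable [TopologicalSpace Ω] [BorelSpace Ω] {K : Ω → Ω → ℝ≥0∞}

theorem pot_tsub_add_pot_min (hK : Continuous (Function.uncurry K)) (C : ℝ≥0∞)
    (b : Measure Ω) (x : Ω) :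
    ∫⁻ y, (C - K x y) ∂b + ∫⁻ y, min (K x y) C ∂b = C * b univ := by
  have hKx : Measurable (K x) := (hK.comp (by fun_prop : Continuous fun y => (x, y))).measurable
  rw [← lintegral_add_right _ (hKx.min measurable_const), ← lintegral_const]
  refine lintegral_congr fun y => ?_
  rcases le_total (K x y) C with h | h
  · rw [min_eq_left h, tsub_add_cancel_of_le h]
  · rw [min_eq_right h, tsub_eq_zero_of_le h, zero_add]

theorem pot_doubledKernel_left (hK : Continuous (Function.uncurry K)) {C : ℝ≥0∞} (hC : C ≠ ⊤)
    (a b : Measure Ω) (x : Ω) :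
    pot (doubledKernel K C) (doubledMeasure a b) (x, true) + ∫⁻ y, min (K x y) C ∂b =
      pot K a x + C * (a univ + b univ) := by
  have hm : Measurable (doubledKernel K C (x, true)) :=
    ((continuous_doubledKernel hK hC).comp (by fun_prop : Continuous fun q =>
      ((x, true), q))).measurable
  rw [pot, lintegral_doubledMeasure a b hm]
  simp only [doubledKernel, if_true, Bool.true_eq_false, if_false]
  rw [add_assoc, pot_tsub_add_pot_min hK, lintegral_add_right _ measurable_const, lintegral_const,
    pot]
  ring

theorem pot_doubledKernel_right (hK : Continuous (Function.uncurry K)) {C : ℝ≥0∞} (hC : C ≠ ⊤)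
    (a b : Measure Ω) (x : Ω) :
    pot (doubledKernel K C) (doubledMeasure a b) (x, false) + ∫⁻ y, min (K x y) C ∂a =
      pot K b x + C * (a univ + b univ) := by
  have hm : Measurable (doubledKernel K C (x, false)) :=
    ((continuous_doubledKernel hK hC).comp (by fun_prop : Continuous fun q =>
      ((x, false), q))).measurable
  rw [pot, lintegral_doubledMeasure a b hm]
  simp only [doubledKernel, if_true, Bool.false_eq_true, if_false]
  rw [add_right_comm, pot_tsub_add_pot_min hK, lintegral_add_right _ measurable_const,
    lintegral_const, pot]
  ring

theorem energy_doubledKernel [SecondCountableTopology Ω]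
    (hsym : ∀ x y, K x y = K y x) (hK : Continuous (Function.uncurry K))
    {C : ℝ≥0∞} (hC : C ≠ ⊤) (a b : Measure Ω) [IsFiniteMeasure a] [IsFiniteMeasure b] :
    energy (doubledKernel K C) (doubledMeasure a b) +
        2 * mutualEnergy (fun x y => min (K x y) C) a b =
      energy K a + energy K b + C * (a univ + b univ) ^ 2 := by
  set L : Ω → Ω → ℝ≥0∞ := fun x y => min (K x y) C
  have hL : Continuous (Function.uncurry L) := hK.min continuous_const
  have hpot := measurable_pot_s14 (continuous_doubledKernel hK hC) (doubledMeasure a b)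
  have ha : ∫⁻ x, pot (doubledKernel K C) (doubledMeasure a b) (x, true) ∂a +
      ∫⁻ x, pot L b x ∂a = energy K a + C * (a univ + b univ) * a univ := by
    rw [← lintegral_add_right _ (measurable_pot_s14 hL b)]
    change ∫⁻ x, (_ + ∫⁻ y, min (K x y) C ∂b) ∂a = _
    simp_rw [pot_doubledKernel_left hK hC]
    rw [lintegral_add_right _ measurable_const, lintegral_const]
    rfl
  have hb : ∫⁻ x, pot (doubledKernel K C) (doubledMeasure a b) (x, false) ∂b +
      ∫⁻ x, pot L a x ∂b = energy K b + C * (a univ + b univ) * b univ := by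
    rw [← lintegral_add_right _ (measurable_pot_s14 hL a)]
    change ∫⁻ x, (_ + ∫⁻ y, min (K x y) C ∂a) ∂b = _
    simp_rw [pot_doubledKernel_right hK hC]
    rw [lintegral_add_right _ measurable_const, lintegral_const]
    rfl
  rw [lintegral_pot_comm (fun x y => by simp only [L, hsym x y]) hL a b] at hb
  change ∫⁻ p, pot _ _ p ∂(doubledMeasure a b) + 2 * ∫⁻ x, pot L b x ∂a = _
  rw [lintegral_doubledMeasure a b hpot]
  calc _ = (∫⁻ x, pot (doubledKernel K C) (doubledMeasure a b) (x, true) ∂a +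
        ∫⁻ x, pot L b x ∂a) + (∫⁻ x, pot (doubledKernel K C) (doubledMeasure a b) (x, false) ∂b +
        ∫⁻ x, pot L b x ∂a) := by ring
    _ = _ := by rw [ha, hb]; ring

end Doubling

/-- Positivity of the energy of `a - b` when the mutual energy is taken with respect to a
truncation of the kernel. -/
theorem two_mul_mutualEnergy_min_le {Ω : Type*} [MetricSpace Ω] [CompactSpace Ω]
    [MeasurableSpace Ω] [BorelSpace Ω]
    {K : Ω → Ω → ℝ≥0∞} (hsym : ∀ x y, K x y = K y x)
    (hK : Continuous (Function.uncurry K))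
    (hmax : ∀ (μ : Measure Ω), IsFiniteMeasure μ → ∀ M : ℝ≥0∞,
      (∀ x ∈ msupp μ, pot K μ x ≤ M) → ∀ x : Ω, pot K μ x ≤ M)
    {C : ℝ≥0∞} (hC : C ≠ ⊤) (a b : Measure Ω) [IsFiniteMeasure a] [IsFiniteMeasure b] :
    2 * mutualEnergy (fun x y => min (K x y) C) a b ≤ energy K a + energy K b := by
  by_contra! hlt
  have hW := continuous_doubledKernel hK hC
  have hWsym := doubledKernel_symm hsym C
  have : Nonempty Ω := by
    by_contra h
    rw [not_nonempty_iff] at h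
    simp [mutualEnergy] at hlt
  obtain ⟨π, hπ⟩ := exists_energy_minimizer_s14 hW
  set e := energy (doubledKernel K C) (π : Measure (Ω × Bool))
  have heC : e < C := by
    by_contra! hCe
    have h1 := energy_mul_sq_le hπ (doubledMeasure a b)
    rw [doubledMeasure_univ] at h1
    have h2 : C * (a univ + b univ) ^ 2 ≤ energy (doubledKernel K C) (doubledMeasure a b) :=
      (mul_le_mul_left hCe _).trans h1
    have h3 := energy_doubledKernel hsym hK hC a b
    have hfin : C * (a univ + b univ) ^ 2 ≠ ⊤ := by finiteness
    have h4 : C * (a univ + b univ) ^ 2 + (energy K a + energy K b) <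
        C * (a univ + b univ) ^ 2 + 2 * mutualEnergy (fun x y => min (K x y) C) a b :=
      (ENNReal.add_lt_add_iff_left hfin).2 hlt
    refine (h4.trans_le (add_le_add_left h2 _)).ne ?_
    rw [h3, add_comm]
  have hfin : e ≠ ⊤ := heC.ne_top
  obtain ⟨μ, ν, hμ, hν, hμν⟩ := exists_eq_doubledMeasure (π : Measure (Ω × Bool))
  have hmass : μ univ + ν univ = 1 := by
    rw [← doubledMeasure_univ, ← hμν, measure_univ]
  have hminle : ∀ (ρ : Measure Ω) x, ∫⁻ y, min (K x y) C ∂ρ ≤ pot K ρ x := fun ρ x =>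
    lintegral_mono fun y => min_le_left _ _
  have hpl := pot_doubledKernel_left hK hC μ ν
  have hpr := pot_doubledKernel_right hK hC μ ν
  rw [hmass, mul_one, ← hμν] at hpl hpr
  have hfrost : ∀ p ∈ msupp (π : Measure (Ω × Bool)), pot (doubledKernel K C) π p ≤ e :=
    fun p hp => pot_le_energy_of_mem_msupp hWsym hW hπ hfin hp
  have hl : ∀ x ∈ msupp μ, pot K μ x + C ≤ e + ∫⁻ y, min (K x y) C ∂ν := fun x hx => by
    rw [← hpl]
    exact add_le_add_left (hfrost _ (hμν ▸ mem_msupp_doubledMeasure_left hx)) _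
  have hr : ∀ x ∈ msupp ν, pot K ν x + C ≤ e + ∫⁻ y, min (K x y) C ∂μ := fun x hx => by
    rw [← hpr]
    exact add_le_add_left (hfrost _ (hμν ▸ mem_msupp_doubledMeasure_right hx)) _
  set S := ⨆ x, pot K μ x
  set T := ⨆ x, pot K ν x
  have hSsupp : ∀ x ∈ msupp μ, pot K μ x ≤ T - (C - e) := fun x hx => by
    refine ENNReal.le_sub_of_add_le_right (by finiteness) ?_
    have h := (hl x hx).trans (add_le_add_right ((hminle ν x).trans (le_iSup _ x)) e)
    rw [← tsub_add_cancel_of_le heC.le, ← add_assoc, add_comm e] at h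
    exact (ENNReal.add_le_add_iff_right hfin).1 h
  have hTsupp : ∀ x ∈ msupp ν, pot K ν x ≤ S - (C - e) := fun x hx => by
    refine ENNReal.le_sub_of_add_le_right (by finiteness) ?_
    have h := (hr x hx).trans (add_le_add_right ((hminle μ x).trans (le_iSup _ x)) e)
    rw [← tsub_add_cancel_of_le heC.le, ← add_assoc, add_comm e] at h
    exact (ENNReal.add_le_add_iff_right hfin).1 h
  have hST : S ≤ T - (C - e) := iSup_le (hmax μ hμ _ hSsupp)
  have hTS : T ≤ S - (C - e) := iSup_le (hmax ν hν _ hTsupp)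
  have hSfin : S ≠ ⊤ := by
    have hbound : ∀ x, pot K μ x ≤ e + C * ν univ := hmax μ hμ _ fun x hx =>
      (le_self_add.trans (hl x hx)).trans (add_le_add_right
        ((lintegral_mono fun y => min_le_right _ _).trans_eq (lintegral_const _)) e)
    exact ne_top_of_le_ne_top (by finiteness) (iSup_le hbound)
  have hd : C - e ≠ 0 := (tsub_pos_of_lt heC).ne'
  have hS0 : S = 0 := by
    by_contra hS
    exact (ENNReal.sub_lt_self hSfin hS hd).not_ge ((hST.trans tsub_le_self).trans hTS)
  have hT0 : T = 0 := by simpa [hS0] using hTS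
  have hμ0 : ∀ x, pot K μ x = 0 := fun x => 
    nonpos_iff_eq_zero.1 ((le_iSup (pot K μ) x).trans_eq hS0)
  have hν0 : ∀ x, pot K ν x = 0 := fun x => 
    nonpos_iff_eq_zero.1 ((le_iSup (pot K ν) x).trans_eq hT0)
  have hpot : ∀ p, pot (doubledKernel K C) (π : Measure (Ω × Bool)) p = C := by
    rintro ⟨x, _ | _⟩
    · have h := hminle μ x
      rw [hμ0, nonpos_iff_eq_zero] at h
      simpa [h, hν0] using hpr x
    · have h := hminle ν x
      rw [hν0, nonpos_iff_eq_zero] at h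
      simpa [h, hμ0] using hpl x
  refine heC.ne ?_
  change ∫⁻ p, pot (doubledKernel K C) (π : Measure (Ω × Bool)) p ∂π = C
  simp [hpot]

/-- The mutual energy is the supremum of the mutual energies of the truncated kernels. -/
theorem mutualEnergy_eq_iSup_min {Ω : Type*} [TopologicalSpace Ω] [SecondCountableTopology Ω]
    [MeasurableSpace Ω] [BorelSpace Ω] {K : Ω → Ω → ℝ≥0∞}
    (hK : Continuous (Function.uncurry K)) (a b : Measure Ω) [SFinite a] [SFinite b] :
    mutualEnergy K a b = ⨆ n : ℕ, mutualEnergy (fun x y => min (K x y) n) a b := by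
  have hprod : ∀ {L : Ω → Ω → ℝ≥0∞}, Continuous (Function.uncurry L) →
      mutualEnergy L a b = ∫⁻ z, Function.uncurry L z ∂(a.prod b) := fun hL =>
    (lintegral_prod _ hL.measurable.aemeasurable).symm
  rw [hprod hK, lintegral_eq_iSup_min _ hK.measurable]
  exact iSup_congr fun n => (hprod (L := fun x y => min (K x y) n)
    (hK.min continuous_const)).symm

/-- (Ninomiya) A symmetric extended-continuous kernel on a compact metric space which
satisfies the first maximum principle is positive definite. -/
theorem ninomiya_posDef
    {Ω : Type*} [MetricSpace Ω] [CompactSpace Ω]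
    [MeasurableSpace Ω] [BorelSpace Ω]
    (K : Ω → Ω → ℝ≥0∞) (hsym : ∀ x y, K x y = K y x)
    (hKcont : Continuous (Function.uncurry K))
    (hmax : ∀ (μ : Measure Ω), IsFiniteMeasure μ → ∀ M : ℝ≥0∞,
      (∀ x ∈ msupp μ, pot K μ x ≤ M) → ∀ x : Ω, pot K μ x ≤ M) :
    ∀ a b : Measure Ω, IsFiniteMeasure a → IsFiniteMeasure b → WellDef K a b →
      0 ≤ signedEnergy K a b := by
  intro a b ha hb hwd
  have hle : 2 * mutualEnergy K a b ≤ energy K a + energy K b := by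
    rw [mutualEnergy_eq_iSup_min hKcont, ENNReal.mul_iSup]
    exact iSup_le fun n => two_mul_mutualEnergy_min_le hsym hKcont hmax (by simp) a b
  have hne : 2 * mutualEnergy K a b ≠ ⊤ := by
    rcases hwd with h | h
    · exact ne_top_of_le_ne_top h hle
    · finiteness
  exact EReal.sub_nonneg (Or.inr (by simpa only [ne_eq, EReal.coe_ennreal_eq_top_iff] using hne))
    (Or.inr (EReal.coe_ennreal_ne_bot _)) |>.2 (by exact_mod_cast hle)
end

section
/- Let 𝕋^d = (ℝ/2πℤ)^d be the flat d-torus with the quotient metric d(x,y) = min over z in the lattice (2πℤ)^d of |y − x − z| (Euclidean norm on ℝ^d), and let σ be the normalized Haar (uniform) measure. For s ≥ d − 2 the Riesz kernel K_s (K_s(x,y) = sign(s) d(x,y)^{-s} for s ≠ 0, K_0(x,y) = −log d(x,y)) is entirely subharmonic on 𝕋^d with respect to σ, and for s > d − 2 it is entirely strictly subharmonic. -/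
open MeasureTheory Set ENNReal

noncomputable section

instance : Fact (0 < 2 * Real.pi) := ⟨by positivity⟩

/-- The flat `d`-torus `(ℝ/2πℤ)^d`. -/
abbrev Torus (d : ℕ) := Fin d → AddCircle (2 * Real.pi)

/-- The flat (Euclidean quotient) metric on the torus. -/
def tdist {d : ℕ} (x y : Torus d) : ℝ := Real.sqrt (∑ i, dist (x i) (y i) ^ 2)

/-- Closed balls of the flat metric. -/
def tBall {d : ℕ} (x : Torus d) (r : ℝ) : Set (Torus d) := {y | tdist x y ≤ r}

/-- The normalized Haar (uniform) measure on the torus. -/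
def tHaar (d : ℕ) : Measure (Torus d) := (ENNReal.ofReal ((2 * Real.pi) ^ d))⁻¹ • volume

/-- The Riesz kernel `K_s(x,y) = sign(s)·d(x,y)^{-s}` (`−log d(x,y)` when `s = 0`) on the
flat torus, with values in the extended reals. -/
def rieszK {d : ℕ} (s : ℝ) (x y : Torus d) : EReal :=
  if 0 < s then ((ENNReal.ofReal (tdist x y) ^ (-s) : ℝ≥0∞) : EReal)
  else if s = 0 then
    (if tdist x y = 0 then (⊤ : EReal) else ((-Real.log (tdist x y) : ℝ) : EReal))
  else ((-(tdist x y ^ (-s)) : ℝ) : EReal)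

/-- Map an extended real to an extended nonnegative real. -/
def toe (x : EReal) : ℝ≥0∞ := if x = ⊤ then ⊤ else ENNReal.ofReal x.toReal

/-- Integral of an `EReal`-valued function over a set. -/
def eInt {Ω : Type*} [MeasurableSpace Ω] (σ : Measure Ω) (s : Set Ω)
    (u : Ω → EReal) : EReal :=
  ((∫⁻ y in s, toe (u y) ∂σ : ℝ≥0∞) : EReal) - ((∫⁻ y in s, toe (-(u y)) ∂σ : ℝ≥0∞) : EReal)

open Metric Filter Topology in
/-- Integration by parts on a closed ball against the weight `(r² - ‖w‖²) / 2`, whose gradient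
is `-w`. -/
theorem setIntegral_closedBall_mul_inner {E : Type*} [NormedAddCommGroup E] [InnerProductSpace ℝ E]
    [FiniteDimensional ℝ E] [MeasurableSpace E] [BorelSpace E] [Nontrivial E]
    (μ : Measure E) [μ.IsAddHaarMeasure] {r r' : ℝ} (hr : 0 < r) (hrr' : r < r')
    {f : E → ℝ} (hf : ContDiffOn ℝ 1 f (ball 0 r')) (v : E) :
    ∫ w in closedBall 0 r, f w * inner ℝ w v ∂μ =
      ∫ w in closedBall 0 r, fderiv ℝ f w v * ((r ^ 2 - ‖w‖ ^ 2) / 2) ∂μ := by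
  set φ : E → ℝ := fun w ↦ (r ^ 2 - (min ‖w‖ r) ^ 2) / 2 with hφ
  have hφ_out : ∀ w, r ≤ ‖w‖ → φ w = 0 := fun w hw ↦ by simp [hφ, min_eq_right hw]
  have hφ_in : ∀ w, ‖w‖ ≤ r → φ w = (r ^ 2 - ‖w‖ ^ 2) / 2 := fun w hw ↦ by
    simp [hφ, min_eq_left hw]
  have hφ_lip : LipschitzWith r.toNNReal φ := by
    refine LipschitzWith.of_dist_le_mul fun x y ↦ ?_
    have h₁ : |min ‖x‖ r - min ‖y‖ r| ≤ ‖x - y‖ :=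
      (abs_min_sub_min_le_max _ _ _ _).trans (by simpa using abs_norm_sub_norm_le x y)
    have h₂ : |min ‖x‖ r + min ‖y‖ r| ≤ 2 * r := by
      rw [abs_of_nonneg (by positivity)]
      linarith [min_le_right ‖x‖ r, min_le_right ‖y‖ r]
    rw [dist_eq_norm, Real.norm_eq_abs, dist_eq_norm]
    have h₃ : φ x - φ y = -((min ‖x‖ r + min ‖y‖ r) * (min ‖x‖ r - min ‖y‖ r)) / 2 := by
      simp only [hφ]; ring
    rw [h₃, abs_div, abs_neg, abs_mul, abs_two]
    have := mul_le_mul h₂ h₁ (abs_nonneg _) (by positivity)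
    rw [Real.coe_toNNReal _ hr.le]
    linarith
  have hφ_supp : HasCompactSupport φ := by
    refine HasCompactSupport.intro (isCompact_closedBall (0 : E) r) fun w hw ↦ hφ_out w ?_
    simp only [mem_closedBall, dist_zero_right, not_le] at hw
    exact hw.le
  let χ : ContDiffBump (0 : E) := ⟨(2 * r + r') / 3, (r + 2 * r') / 3, by linarith, by linarith⟩
  have hχ : ∀ w ∈ tsupport (fun w ↦ χ w * f w), w ∈ ball (0 : E) r' := fun w hw ↦ by
    have h := tsupport_mul_subset_left hw
    rw [χ.tsupport_eq] at h
    have h' : ‖w‖ ≤ (r + 2 * r') / 3 := by simpa [χ] using h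
    simp only [mem_ball, dist_zero_right]
    linarith
  have hg_smooth : ContDiff ℝ 1 (fun w ↦ χ w * f w) := by
    refine contDiff_iff_contDiffAt.2 fun w ↦ ?_
    by_cases hw : w ∈ tsupport (fun w ↦ χ w * f w)
    · exact χ.contDiff.contDiffAt.mul (hf.contDiffAt (isOpen_ball.mem_nhds (hχ w hw)))
    · exact contDiffAt_const.congr_of_eventuallyEq (notMem_tsupport_iff_eventuallyEq.1 hw)
  obtain ⟨C, hC⟩ : ∃ C, LipschitzWith C (fun w ↦ χ w * f w) :=
    ContDiff.lipschitzWith_of_hasCompactSupport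
    (χ.hasCompactSupport.mul_right (f' := f)) hg_smooth one_ne_zero
  have hg_eq : ∀ w, ‖w‖ ≤ r → (fun w ↦ χ w * f w) =ᶠ[𝓝 w] f := fun w hw ↦ by
    have h : w ∈ ball (0 : E) χ.rIn := by
      simp only [mem_ball, dist_zero_right, χ]; linarith
    filter_upwards [isOpen_ball.mem_nhds h] with z hz
    rw [χ.one_of_mem_closedBall (ball_subset_closedBall hz), one_mul]
  have hsphere : ∀ᵐ w ∂μ, ‖w‖ ≠ r := by
    have := Measure.addHaar_sphere μ (0 : E) r
    rw [ae_iff]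
    convert this using 2
    ext w; simp
  have key := LipschitzWith.integral_lineDeriv_mul_eq (μ := μ) hC hφ_lip hφ_supp v
  rw [← integral_indicator measurableSet_closedBall, ← integral_indicator measurableSet_closedBall]
  refine Eq.trans ?_ (key.symm.trans ?_)
  · refine integral_congr_ae ?_
    filter_upwards [hsphere] with w hw
    rcases lt_or_gt_of_ne hw with h | h
    · rw [indicator_of_mem (by simpa using h.le)]
      have h₁ : φ =ᶠ[𝓝 w] fun w ↦ (r ^ 2 - ‖w‖ ^ 2) / 2 := by
        filter_upwards [continuous_norm.continuousAt.eventually_lt_const h] with z hz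
        exact hφ_in z hz.le
      have h₂ : HasFDerivAt (fun w : E ↦ (r ^ 2 - ‖w‖ ^ 2) / 2) _ w :=
        (((hasFDerivAt_id w).norm_sq).const_sub (r ^ 2)).mul_const (2 : ℝ)⁻¹
      rw [h₁.lineDeriv_eq, (h₂.hasLineDerivAt (-v)).lineDeriv, (hg_eq w h.le).eq_of_nhds]
      simp
      ring
    · rw [indicator_of_notMem (by simpa using h)]
      have h₁ : φ =ᶠ[𝓝 w] fun _ ↦ 0 := by
        filter_upwards [continuous_norm.continuousAt.eventually_const_lt h] with z hz
        exact hφ_out z hz.le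
      rw [h₁.lineDeriv_eq]
      simp [lineDeriv]
  · congr 1
    ext w
    by_cases h : ‖w‖ ≤ r
    · rw [indicator_of_mem (by simpa using h), hφ_in w h, (hg_eq w h).lineDeriv_eq,
        DifferentiableAt.lineDeriv_eq_fderiv]
      refine (hf.contDiffAt (isOpen_ball.mem_nhds ?_)).differentiableAt one_ne_zero
      simp only [mem_ball, dist_zero_right]; linarith
    · rw [indicator_of_notMem (by simpa using h), hφ_out w (not_le.1 h).le, mul_zero]

theorem norm_sq_add_smul_pos {E : Type*} [NormedAddCommGroup E] [InnerProductSpace ℝ E] {e w : E}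
    {t : ℝ} (h : ‖t • w‖ < ‖e‖) : 0 < ‖e + t • w‖ ^ 2 := by
  have h₁ : e + t • w ≠ 0 := fun h₀ ↦ by
    rw [eq_neg_of_add_eq_zero_left h₀, norm_neg] at h
    exact lt_irrefl _ h
  positivity

open Metric in
/-- The divergence theorem on a closed ball for the radial field `x ↦ -‖x‖ ^ (2 * q) • x`
centred at `-e`. -/
theorem setIntegral_closedBall_neg_rpow_mul_inner {E : Type*} [NormedAddCommGroup E]
    [InnerProductSpace ℝ E] [FiniteDimensional ℝ E] [MeasurableSpace E] [BorelSpace E]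
    [Nontrivial E] (μ : Measure E) [μ.IsAddHaarMeasure] {r t : ℝ} (hr : 0 < r) (ht : 0 < t)
    {e : E} (he : t * r < ‖e‖) (q : ℝ) :
    ∫ w in closedBall 0 r, -(‖e + t • w‖ ^ 2) ^ q * inner ℝ (e + t • w) w ∂μ =
      ∫ w in closedBall 0 r, -(t * (2 * q + Module.finrank ℝ E)) * (‖e + t • w‖ ^ 2) ^ q *
        ((r ^ 2 - ‖w‖ ^ 2) / 2) ∂μ := by
  set b := stdOrthonormalBasis ℝ E
  have hr' : r < ‖e‖ / t := by rw [lt_div_iff₀ ht]; linarith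
  have hpos : ∀ w ∈ ball (0 : E) (‖e‖ / t), 0 < ‖e + t • w‖ ^ 2 := fun w hw ↦ by
    refine norm_sq_add_smul_pos ?_
    rw [norm_smul, Real.norm_of_nonneg ht.le]
    rw [mem_ball, dist_zero_right, lt_div_iff₀ ht] at hw
    linarith
  have hsub : closedBall (0 : E) r ⊆ ball 0 (‖e‖ / t) := closedBall_subset_ball hr'
  let f : Fin (Module.finrank ℝ E) → E → ℝ :=
    fun i w ↦ -(‖e + t • w‖ ^ 2) ^ q * inner ℝ (e + t • w) (b i)
  have hf : ∀ i, ContDiffOn ℝ 1 (f i) (ball 0 (‖e‖ / t)) := fun i w hw ↦ by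
    refine ContDiffAt.contDiffWithinAt ?_
    have h₁ : ContDiffAt ℝ 1 (fun w : E ↦ e + t • w) w := by fun_prop
    exact ((h₁.norm_sq ℝ).rpow_const_of_ne (hpos w hw).ne').neg.mul
      (h₁.inner ℝ contDiffAt_const)
  have hfderiv : ∀ i, ∀ w ∈ ball (0 : E) (‖e‖ / t), fderiv ℝ (f i) w (b i) =
      -t * (2 * q * (‖e + t • w‖ ^ 2) ^ (q - 1) * (inner ℝ (e + t • w) (b i)) ^ 2 +
        (‖e + t • w‖ ^ 2) ^ q) := fun i w hw ↦ by
    have h₁ : HasFDerivAt (fun w : E ↦ e + t • w) (t • ContinuousLinearMap.id ℝ E) w :=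
      ((hasFDerivAt_id w).const_smul t).const_add e
    have h₂ := ((h₁.norm_sq).rpow_const (p := q) (Or.inl (hpos w hw).ne')).neg.mul
      (h₁.inner ℝ (hasFDerivAt_const (b i) w))
    have h₃ := h₂.fderiv
    change fderiv ℝ (f i) w = _ at h₃
    rw [h₃]
    simp [real_inner_smul_left, inner_add_left]
    ring
  have hint : ∀ i, IntegrableOn (fun w ↦ f i w * inner ℝ w (b i)) (closedBall 0 r) μ := fun i ↦
    (((hf i).continuousOn.mono hsub).mul (by fun_prop)).integrableOn_compact
      (isCompact_closedBall _ _)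
  have hint' : ∀ i, IntegrableOn (fun w ↦ fderiv ℝ (f i) w (b i) * ((r ^ 2 - ‖w‖ ^ 2) / 2))
      (closedBall 0 r) μ := fun i ↦ by
    refine ContinuousOn.integrableOn_compact (isCompact_closedBall _ _) ?_
    have h := (hf i).continuousOn_fderiv_of_isOpen isOpen_ball le_rfl
    exact ((h.mono hsub).clm_apply continuousOn_const).mul (by fun_prop)
  calc
    _ = ∫ w in closedBall 0 r, ∑ i, f i w * inner ℝ w (b i) ∂μ := by
      refine setIntegral_congr_fun measurableSet_closedBall fun w _ ↦ ?_
      simp only [f, mul_assoc, ← Finset.mul_sum]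
      rw [← b.sum_inner_mul_inner (e + t • w) w]
      simp only [real_inner_comm]
    _ = ∑ i, ∫ w in closedBall 0 r, f i w * inner ℝ w (b i) ∂μ :=
      integral_finsetSum _ fun i _ ↦ hint i
    _ = ∑ i, ∫ w in closedBall 0 r, fderiv ℝ (f i) w (b i) * ((r ^ 2 - ‖w‖ ^ 2) / 2) ∂μ :=
      Finset.sum_congr rfl fun i _ ↦ setIntegral_closedBall_mul_inner μ hr hr' (hf i) (b i)
    _ = ∫ w in closedBall 0 r, ∑ i, fderiv ℝ (f i) w (b i) * ((r ^ 2 - ‖w‖ ^ 2) / 2) ∂μ :=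
      (integral_finsetSum _ fun i _ ↦ hint' i).symm
    _ = _ := by
      refine setIntegral_congr_fun measurableSet_closedBall fun w hw ↦ ?_
      have hN := hpos w (hsub hw)
      have h₁ : ∑ i, (inner ℝ (e + t • w) (b i)) ^ 2 = ‖e + t • w‖ ^ 2 := by
        rw [← b.sum_sq_norm_inner_left (e + t • w)]
        simp
      have h₂ : (‖e + t • w‖ ^ 2) ^ (q - 1) * ‖e + t • w‖ ^ 2 = (‖e + t • w‖ ^ 2) ^ q := by
        rw [Real.rpow_sub_one hN.ne', div_mul_cancel₀ _ hN.ne']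
      simp only [fun i ↦ hfderiv i w (hsub hw), ← Finset.sum_mul, ← Finset.mul_sum,
        Finset.sum_add_distrib, h₁, mul_assoc (2 * q), h₂, Finset.sum_const, Finset.card_univ,
        Fintype.card_fin, nsmul_eq_mul]
      ring

open Metric in
theorem setIntegral_closedBall_neg_rpow_mul_inner_nonneg {E : Type*} [NormedAddCommGroup E]
    [InnerProductSpace ℝ E] [FiniteDimensional ℝ E] [MeasurableSpace E] [BorelSpace E]
    [Nontrivial E] (μ : Measure E) [μ.IsAddHaarMeasure] {r t : ℝ} (hr : 0 < r) (ht : 0 < t)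
    {e : E} (he : t * r < ‖e‖) {q : ℝ} (hq : 2 * q + Module.finrank ℝ E ≤ 0) :
    0 ≤ ∫ w in closedBall 0 r, -(‖e + t • w‖ ^ 2) ^ q * inner ℝ (e + t • w) w ∂μ := by
  rw [setIntegral_closedBall_neg_rpow_mul_inner μ hr ht he]
  refine setIntegral_nonneg measurableSet_closedBall fun w hw ↦ ?_
  rw [mem_closedBall, dist_zero_right] at hw
  have h₁ : 0 ≤ r ^ 2 - ‖w‖ ^ 2 := by nlinarith [norm_nonneg w]
  have h₂ : 0 ≤ -(t * (2 * q + Module.finrank ℝ E)) := by nlinarith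
  positivity

open Metric in
theorem setIntegral_closedBall_neg_rpow_mul_inner_pos {E : Type*} [NormedAddCommGroup E]
    [InnerProductSpace ℝ E] [FiniteDimensional ℝ E] [MeasurableSpace E] [BorelSpace E]
    [Nontrivial E] (μ : Measure E) [μ.IsAddHaarMeasure] {r t : ℝ} (hr : 0 < r) (ht : 0 < t)
    {e : E} (he : t * r < ‖e‖) {q : ℝ} (hq : 2 * q + Module.finrank ℝ E < 0) :
    0 < ∫ w in closedBall 0 r, -(‖e + t • w‖ ^ 2) ^ q * inner ℝ (e + t • w) w ∂μ := by
  rw [setIntegral_closedBall_neg_rpow_mul_inner μ hr ht he]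
  have hpos : ∀ w ∈ closedBall (0 : E) r, 0 < ‖e + t • w‖ ^ 2 := fun w hw ↦ by
    refine norm_sq_add_smul_pos (lt_of_le_of_lt ?_ he)
    rw [mem_closedBall, dist_zero_right] at hw
    rw [norm_smul, Real.norm_of_nonneg ht.le]
    gcongr
  have h₂ : 0 < -(t * (2 * q + Module.finrank ℝ E)) := by nlinarith
  rw [setIntegral_pos_iff_support_of_nonneg_ae]
  · refine (measure_ball_pos μ (0 : E) hr).trans_le (measure_mono fun w hw ↦ ?_)
    refine ⟨?_, ball_subset_closedBall hw⟩
    have hN := hpos w (ball_subset_closedBall hw)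
    rw [mem_ball, dist_zero_right] at hw
    have h₁ : 0 < r ^ 2 - ‖w‖ ^ 2 := by nlinarith [norm_nonneg w]
    rw [Function.mem_support]
    positivity
  · refine (ae_restrict_iff' measurableSet_closedBall).2 (ae_of_all _ fun w hw ↦ ?_)
    rw [mem_closedBall, dist_zero_right] at hw
    have h₁ : 0 ≤ r ^ 2 - ‖w‖ ^ 2 := by nlinarith [norm_nonneg w]
    simp only [Pi.zero_apply]
    positivity
  · refine ContinuousOn.integrableOn_compact (isCompact_closedBall _ _) ?_
    refine (continuousOn_const.mul ?_).mul (by fun_prop)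
    exact ContinuousOn.rpow_const (by fun_prop) fun w hw ↦ Or.inl (hpos w hw).ne'

open Metric in
/-- Differentiation under the integral sign of the mean of a radial function over dilated balls. -/
theorem hasDerivAt_setIntegral_closedBall_radial {E : Type*} [NormedAddCommGroup E]
    [InnerProductSpace ℝ E] [FiniteDimensional ℝ E] [MeasurableSpace E] [BorelSpace E]
    (μ : Measure E) [μ.IsAddHaarMeasure] {r : ℝ} (hr : 0 < r) {e : E} (he : r < ‖e‖)
    {c q : ℝ} {κ : ℝ → ℝ} (hκ : ∀ m, 0 < m → HasDerivAt κ (-c * m ^ q) m)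
    {t : ℝ} (ht : t ∈ Icc (0 : ℝ) 1) :
    HasDerivAt (fun t : ℝ ↦ ∫ w in closedBall 0 r, κ (‖e + t • w‖ ^ 2) ∂μ)
      (∫ w in closedBall 0 r, 2 * c * (-(‖e + t • w‖ ^ 2) ^ q * inner ℝ (e + t • w) w) ∂μ) t := by
  obtain ⟨a, ha₁, ha⟩ : ∃ a : ℝ, 1 < a ∧ a * r < ‖e‖ := by
    refine ⟨(1 + ‖e‖ / r) / 2, ?_, ?_⟩
    · have : 1 < ‖e‖ / r := by rwa [one_lt_div hr]
      linarith
    · have : (1 + ‖e‖ / r) / 2 * r = (r + ‖e‖) / 2 := by field_simp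
      linarith
  have hpos : ∀ t ∈ Icc (-a) a, ∀ w ∈ closedBall (0 : E) r, 0 < ‖e + t • w‖ ^ 2 :=
    fun t ht w hw ↦ by
      refine norm_sq_add_smul_pos (lt_of_le_of_lt ?_ ha)
      rw [mem_closedBall, dist_zero_right] at hw
      rw [norm_smul, Real.norm_eq_abs]
      have := abs_le.2 ht
      gcongr
  have hcont' : ContinuousOn (fun p : ℝ × E ↦
      2 * c * (-(‖e + p.1 • p.2‖ ^ 2) ^ q * inner ℝ (e + p.1 • p.2) p.2))
      (Icc (-a) a ×ˢ closedBall 0 r) := by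
    refine continuousOn_const.mul ((ContinuousOn.rpow_const (by fun_prop) ?_).neg.mul
      (by fun_prop))
    exact fun p hp ↦ Or.inl (hpos p.1 hp.1 p.2 hp.2).ne'
  have hcont : ∀ t ∈ Icc (-a) a,
      ContinuousOn (fun w : E ↦ κ (‖e + t • w‖ ^ 2)) (closedBall 0 r) := fun t ht w hw ↦ by
    have h₁ : ContinuousAt (fun w : E ↦ ‖e + t • w‖ ^ 2) w := by fun_prop
    exact (ContinuousAt.comp (f := fun w : E ↦ ‖e + t • w‖ ^ 2)
      (hκ _ (hpos t ht w hw)).continuousAt h₁).continuousWithinAt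
  obtain ⟨C, hC⟩ :=
    (isCompact_Icc.prod (isCompact_closedBall (0 : E) r)).exists_bound_of_continuousOn hcont'
  have hta : t ∈ Ioo (-a) a := ⟨by linarith [ht.1], by linarith [ht.2]⟩
  have hnhds : Icc (-a) a ∈ nhds t := Icc_mem_nhds hta.1 hta.2
  refine (hasDerivAt_integral_of_dominated_loc_of_deriv_le (bound := fun _ ↦ C)
    (F' := fun t w ↦ 2 * c * (-(‖e + t • w‖ ^ 2) ^ q * inner ℝ (e + t • w) w))
    hnhds ?_ ?_ ?_ ?_ ?_ ?_).2
  · filter_upwards [hnhds] with t ht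
    exact (hcont t ht).aestronglyMeasurable measurableSet_closedBall
  · exact (hcont t (Ioo_subset_Icc_self hta)).integrableOn_compact (isCompact_closedBall _ _)
  · refine ContinuousOn.aestronglyMeasurable ?_ measurableSet_closedBall
    exact hcont'.comp (f := fun w ↦ (t, w)) (by fun_prop)
      fun w hw ↦ ⟨Ioo_subset_Icc_self hta, hw⟩
  · refine (ae_restrict_iff' measurableSet_closedBall).2 (ae_of_all _ fun w hw t ht ↦ ?_)
    exact hC (t, w) ⟨ht, hw⟩
  · exact integrableOn_const measure_closedBall_lt_top.ne
  · refine (ae_restrict_iff' measurableSet_closedBall).2 (ae_of_all _ fun w hw t ht ↦ ?_)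
    have h₁ : HasDerivAt (fun t : ℝ ↦ e + t • w) w t := by
      simpa using ((hasDerivAt_id t).smul_const w).const_add e
    have h₂ := (hκ _ (hpos t ht w hw)).comp t h₁.norm_sq
    convert! h₂ using 1
    ring

open Metric in
/-- Submean value inequality over closed balls for the radial function `x ↦ κ (‖x‖ ^ 2)`. -/
theorem mul_measureReal_le_setIntegral_closedBall_radial {E : Type*} [NormedAddCommGroup E]
    [InnerProductSpace ℝ E] [FiniteDimensional ℝ E] [MeasurableSpace E] [BorelSpace E]
    [Nontrivial E] (μ : Measure E) [μ.IsAddHaarMeasure] {r : ℝ} (hr : 0 < r) {e : E}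
    (he : r < ‖e‖) {c q : ℝ} (hc : 0 < c) {κ : ℝ → ℝ}
    (hκ : ∀ m, 0 < m → HasDerivAt κ (-c * m ^ q) m) (hq : 2 * q + Module.finrank ℝ E ≤ 0) :
    κ (‖e‖ ^ 2) * μ.real (closedBall 0 r) ≤ ∫ w in closedBall 0 r, κ (‖e + w‖ ^ 2) ∂μ := by
  have hmono := monotoneOn_of_hasDerivWithinAt_nonneg (convex_Icc (0 : ℝ) 1)
    (fun t ht ↦ (hasDerivAt_setIntegral_closedBall_radial μ hr he hκ
      ht).continuousAt.continuousWithinAt)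
    (fun t ht ↦ (hasDerivAt_setIntegral_closedBall_radial μ hr he hκ
      (interior_subset ht)).hasDerivWithinAt) fun t ht ↦ ?_
  · simpa [mul_comm] using hmono (left_mem_Icc.2 zero_le_one) (right_mem_Icc.2 zero_le_one)
      zero_le_one
  · rw [interior_Icc] at ht
    rw [integral_const_mul]
    have := setIntegral_closedBall_neg_rpow_mul_inner_nonneg μ hr ht.1 (by nlinarith [ht.2]) hq
      (e := e)
    positivity

open Metric in
/-- Strict submean value inequality over closed balls for the radial function
`x ↦ κ (‖x‖ ^ 2)`. -/
theorem mul_measureReal_lt_setIntegral_closedBall_radial {E : Type*} [NormedAddCommGroup E]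
    [InnerProductSpace ℝ E] [FiniteDimensional ℝ E] [MeasurableSpace E] [BorelSpace E]
    [Nontrivial E] (μ : Measure E) [μ.IsAddHaarMeasure] {r : ℝ} (hr : 0 < r) {e : E}
    (he : r < ‖e‖) {c q : ℝ} (hc : 0 < c) {κ : ℝ → ℝ}
    (hκ : ∀ m, 0 < m → HasDerivAt κ (-c * m ^ q) m) (hq : 2 * q + Module.finrank ℝ E < 0) :
    κ (‖e‖ ^ 2) * μ.real (closedBall 0 r) < ∫ w in closedBall 0 r, κ (‖e + w‖ ^ 2) ∂μ := by
  have hmono := strictMonoOn_of_hasDerivWithinAt_pos (convex_Icc (0 : ℝ) 1)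
    (fun t ht ↦ (hasDerivAt_setIntegral_closedBall_radial μ hr he hκ
      ht).continuousAt.continuousWithinAt)
    (fun t ht ↦ (hasDerivAt_setIntegral_closedBall_radial μ hr he hκ
      (interior_subset ht)).hasDerivWithinAt) fun t ht ↦ ?_
  · simpa [mul_comm] using hmono (left_mem_Icc.2 zero_le_one) (right_mem_Icc.2 zero_le_one)
      zero_lt_one
  · rw [interior_Icc] at ht
    rw [integral_const_mul]
    have := setIntegral_closedBall_neg_rpow_mul_inner_pos μ hr ht.1 (by nlinarith [ht.2]) hq
      (e := e)
    positivity

/-- The Riesz kernel as a function of the squared distance. -/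
def rieszProfile (s m : ℝ) : ℝ :=
  if 0 < s then m ^ (-s / 2) else if s = 0 then -(Real.log m / 2) else -m ^ (-s / 2)

theorem exists_hasDerivAt_rieszProfile (s : ℝ) :
    ∃ c > 0, ∀ m, 0 < m → HasDerivAt (rieszProfile s) (-c * m ^ (-s / 2 - 1)) m := by
  rcases lt_trichotomy s 0 with hs | rfl | hs
  · refine ⟨-s / 2, by linarith, fun m hm ↦ ?_⟩
    have h : rieszProfile s = fun m ↦ -m ^ (-s / 2) := by
      ext m; simp [rieszProfile, hs.not_gt, hs.ne]
    rw [h, neg_mul]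
    exact (Real.hasDerivAt_rpow_const (Or.inl hm.ne')).neg
  · refine ⟨1 / 2, by norm_num, fun m hm ↦ ?_⟩
    have h : rieszProfile 0 = fun m ↦ -(Real.log m / 2) := by
      ext m; simp [rieszProfile]
    rw [h]
    convert! ((Real.hasDerivAt_log hm.ne').div_const 2).neg using 1
    norm_num [Real.rpow_neg_one]
    ring
  · refine ⟨s / 2, by linarith, fun m hm ↦ ?_⟩
    have h : rieszProfile s = fun m ↦ m ^ (-s / 2) := by
      ext m; simp [rieszProfile, hs]
    rw [h]
    convert! Real.hasDerivAt_rpow_const (p := -s / 2) (Or.inl hm.ne') using 1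
    ring

theorem continuousOn_rieszProfile (s : ℝ) : ContinuousOn (rieszProfile s) (Ioi 0) := by
  obtain ⟨c, -, h⟩ := exists_hasDerivAt_rieszProfile s
  exact fun m hm ↦ (h m hm).continuousAt.continuousWithinAt

theorem antitoneOn_rieszProfile (s : ℝ) : AntitoneOn (rieszProfile s) (Ioi 0) := by
  obtain ⟨c, hc, h⟩ := exists_hasDerivAt_rieszProfile s
  refine antitoneOn_of_hasDerivWithinAt_nonpos (convex_Ioi 0) (continuousOn_rieszProfile s)
    (fun m hm ↦ (h m (interior_subset hm)).hasDerivWithinAt) fun m hm ↦ ?_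
  have hm' : 0 < m := interior_subset hm
  have : 0 < m ^ (-s / 2 - 1) := by positivity
  nlinarith

theorem tdist_pos {d : ℕ} {x y : Torus d} (h : x ≠ y) : 0 < tdist x y := by
  obtain ⟨i, hi⟩ := Function.ne_iff.1 h
  refine Real.sqrt_pos.2 (Finset.sum_pos' (fun _ _ ↦ by positivity) ⟨i, Finset.mem_univ i, ?_⟩)
  have := dist_pos.2 hi
  positivity

theorem Continuous.tdist {X : Type*} [TopologicalSpace X] {d : ℕ} {f g : X → Torus d}
    (hf : Continuous f) (hg : Continuous g) : Continuous fun p ↦ tdist (f p) (g p) := by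
  unfold _root_.tdist
  fun_prop

theorem isClosed_tBall {d : ℕ} (x : Torus d) (r : ℝ) : IsClosed (tBall x r) :=
  isClosed_Iic.preimage (continuous_const.tdist continuous_id)

theorem rieszK_eq_coe_rieszProfile {d : ℕ} (s : ℝ) {x y : Torus d} (h : x ≠ y) :
    rieszK s x y = ((rieszProfile s (tdist x y ^ 2) : ℝ) : EReal) := by
  have hpos := tdist_pos h
  have hpow : (tdist x y ^ 2) ^ (-s / 2) = tdist x y ^ (-s) := by
    rw [← Real.rpow_natCast, ← Real.rpow_mul hpos.le]
    congr 1
    push_cast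
    ring
  have hlog : Real.log (tdist x y ^ 2) / 2 = Real.log (tdist x y) := by
    rw [Real.log_pow]
    push_cast
    ring
  unfold rieszK rieszProfile
  rw [hpow, hlog]
  split_ifs with h₁ h₂ h₃
  · rw [ENNReal.ofReal_rpow_of_pos hpos, EReal.coe_ennreal_ofReal, max_eq_left (by positivity)]
  · exact absurd h₃ hpos.ne'
  · rfl
  · rfl

theorem toe_coe (a : ℝ) : toe (a : EReal) = ENNReal.ofReal a := by
  simp [toe]

theorem eInt_eq_coe_setIntegral {Ω : Type*} [MeasurableSpace Ω] {σ : Measure Ω} {B : Set Ω}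
    (hB : MeasurableSet B) {u : Ω → EReal} {f : Ω → ℝ} (hf : IntegrableOn f B σ)
    (hu : ∀ z ∈ B, u z = (f z : EReal)) : eInt σ B u = ((∫ z in B, f z ∂σ : ℝ) : EReal) := by
  have h₁ : ∫⁻ z in B, toe (u z) ∂σ = ∫⁻ z in B, ENNReal.ofReal (f z) ∂σ :=
    setLIntegral_congr_fun hB fun z hz ↦ by simp only [hu z hz, toe_coe]
  have h₂ : ∫⁻ z in B, toe (-(u z)) ∂σ = ∫⁻ z in B, ENNReal.ofReal (-f z) ∂σ :=
    setLIntegral_congr_fun hB fun z hz ↦ by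
      simp only [hu z hz, ← EReal.coe_neg, toe_coe]
  have hcoe : ∀ a : ℝ≥0∞, a ≠ ∞ → (a : EReal) = (a.toReal : EReal) := fun a ha ↦
    (EReal.coe_toReal (by simpa using ha) (by simp)).symm.trans (by simp)
  rw [eInt, h₁, h₂, integral_eq_lintegral_pos_part_sub_lintegral_neg_part hf, EReal.coe_sub,
    hcoe _ hf.lintegral_lt_top.ne, hcoe (∫⁻ z in B, ENNReal.ofReal (-f z) ∂σ)
      hf.neg.lintegral_lt_top.ne]

/-- The exponential map of the flat torus at `x`. -/
def torusExp {d : ℕ} (x : Torus d) (w : EuclideanSpace ℝ (Fin d)) : Torus d :=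
  fun i ↦ x i + (w i : AddCircle (2 * Real.pi))

/-- The exponential map identifies small Euclidean balls with balls of the torus. -/
theorem measurePreserving_torusExp {d : ℕ} (x : Torus d) {r : ℝ} (hr : r < Real.pi) :
    MeasurePreserving (torusExp x) (volume.restrict (Metric.closedBall 0 r))
      (volume.restrict (tBall x r)) := by
  set box : Set (Fin d → ℝ) := univ.pi fun _ ↦ Ioc (-Real.pi) (-Real.pi + 2 * Real.pi)
  have h₁ : MeasurePreserving (fun (a : Fin d → ℝ) i ↦ (a i : AddCircle (2 * Real.pi)))
      (volume.restrict box) volume := by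
    rw [volume_pi, Measure.restrict_pi_pi]
    exact measurePreserving_pi _ _ fun _ ↦ AddCircle.measurePreserving_mk _ _
  have hbox : MeasurableSet box := MeasurableSet.univ_pi fun _ ↦ measurableSet_Ioc
  have h₂ := (h₁.comp ((PiLp.volume_preserving_ofLp (Fin d)).restrict_preimage hbox))
  have h₃ := (measurePreserving_add_left volume x).comp h₂
  have h₄ := h₃.restrict_preimage (isClosed_tBall x r).measurableSet
  rw [Measure.restrict_restrict
    ((isClosed_tBall x r).measurableSet.preimage h₃.measurable)] at h₄
  convert! h₄ using 2
  ext w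
  have hdist : (∀ i, |w i| ≤ Real.pi) → tdist x (torusExp x w) = ‖w‖ := fun hw ↦ by
    rw [tdist, EuclideanSpace.norm_eq]
    congr 1
    refine Finset.sum_congr rfl fun i _ ↦ ?_
    rw [torusExp, dist_self_add_right,
      (AddCircle.norm_coe_eq_abs_iff _ (by positivity)).2, Real.norm_eq_abs]
    rw [abs_of_pos (by positivity : 0 < 2 * Real.pi)]
    linarith [hw i]
  constructor
  · intro hw
    rw [Metric.mem_closedBall, dist_zero_right] at hw
    have hwi : ∀ i, |w i| < Real.pi := fun i ↦
      ((PiLp.norm_apply_le w i).trans hw).trans_lt hr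
    refine ⟨?_, fun i _ ↦ ?_⟩
    · change tdist x (torusExp x w) ≤ r
      rwa [hdist fun i ↦ (hwi i).le]
    · have := abs_lt.1 (hwi i)
      exact ⟨this.1, by linarith [this.2]⟩
  · rintro ⟨hw₁, hw₂⟩
    change tdist x (torusExp x w) ≤ r at hw₁
    rw [hdist fun i ↦ ?_] at hw₁
    · simpa using hw₁
    · have := hw₂ i (mem_univ i)
      exact abs_le.2 ⟨this.1.le, by linarith [this.2]⟩

/-- Every point of the circle has a real lift whose absolute value is its norm. -/
theorem exists_coe_eq_abs_eq_norm (a : AddCircle (2 * Real.pi)) :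
    ∃ b : ℝ, (b : AddCircle (2 * Real.pi)) = a ∧ |b| = ‖a‖ := by
  have h := (AddCircle.equivIoc (2 * Real.pi) (-Real.pi)).symm_apply_apply a
  set b := AddCircle.equivIoc (2 * Real.pi) (-Real.pi) a
  have hb : ((b : ℝ) : AddCircle (2 * Real.pi)) = a := h
  refine ⟨b, hb, ?_⟩
  rw [← hb, (AddCircle.norm_coe_eq_abs_iff _ (by positivity)).2]
  rw [abs_of_pos (by positivity : 0 < 2 * Real.pi)]
  exact abs_le.2 ⟨by linarith [b.2.1], by linarith [b.2.2]⟩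

/-- The displacement `x - y` lifts to a vector `e` of length `tdist x y`; moving `x` along `w` brings
it no farther from `y` than `‖e + w‖`. -/
theorem exists_lift_tdist {d : ℕ} (x y : Torus d) :
    ∃ e : EuclideanSpace ℝ (Fin d), ‖e‖ = tdist x y ∧ ∀ w, tdist (torusExp x w) y ≤ ‖e + w‖ := by
  choose b hb hb' using fun i ↦ exists_coe_eq_abs_eq_norm (x i - y i)
  refine ⟨WithLp.toLp 2 b, ?_, fun w ↦ ?_⟩
  · rw [EuclideanSpace.norm_eq, tdist]
    simp only [Real.norm_eq_abs, hb', dist_eq_norm]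
  · rw [EuclideanSpace.norm_eq, tdist]
    gcongr with i
    have h : torusExp x w i - y i = ((b i + w i : ℝ) : AddCircle (2 * Real.pi)) := by
      rw [AddCircle.coe_add, hb, torusExp]
      abel
    rw [dist_eq_norm, h]
    exact QuotientAddGroup.norm_mk_le_norm

theorem continuousOn_rieszProfile_tdist {d : ℕ} (s : ℝ) (y : Torus d) :
    ContinuousOn (fun z ↦ rieszProfile s (tdist z y ^ 2)) {y}ᶜ := by
  refine (continuousOn_rieszProfile s).comp (Continuous.continuousOn ?_) fun z hz ↦ ?_
  · exact (continuous_id.tdist continuous_const).pow 2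
  · have := tdist_pos hz
    exact pow_pos this 2

/-- The lift of a ball of the torus to Euclidean space does not increase the Riesz kernel. -/
theorem exists_setIntegral_rieszProfile_le {d : ℕ} (s : ℝ) {x y : Torus d} {r : ℝ}
    (hrπ : r < Real.pi) (hxy : tBall x r ⊆ {y}ᶜ) :
    ∃ e : EuclideanSpace ℝ (Fin d), r < ‖e‖ ∧ ‖e‖ = tdist x y ∧
      ∫ w in Metric.closedBall 0 r, rieszProfile s (‖e + w‖ ^ 2) ≤
        ∫ z in tBall x r, rieszProfile s (tdist z y ^ 2) := by
  obtain ⟨e, he, hle⟩ := exists_lift_tdist x y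
  have hre : r < ‖e‖ := by
    rw [he]
    by_contra! h
    exact hxy (show y ∈ tBall x r from h) rfl
  refine ⟨e, hre, he, ?_⟩
  have hP := measurePreserving_torusExp x hrπ
  have hint : IntegrableOn (fun z ↦ rieszProfile s (tdist z y ^ 2)) (tBall x r) :=
    ((continuousOn_rieszProfile_tdist s y).mono hxy).integrableOn_compact
      (isClosed_tBall x r).isCompact
  rw [← hP.map_eq, integral_map hP.aemeasurable (hP.map_eq ▸ hint.aestronglyMeasurable)]
  have hpos : ∀ w ∈ Metric.closedBall (0 : EuclideanSpace ℝ (Fin d)) r, 0 < ‖e + w‖ ^ 2 :=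
    fun w hw ↦ by
      rw [Metric.mem_closedBall, dist_zero_right] at hw
      simpa using norm_sq_add_smul_pos (e := e) (w := w) (t := 1) (by simpa using hw.trans_lt hre)
  refine integral_mono_ae ?_ (hP.integrable_comp_of_integrable hint) ?_
  · refine ContinuousOn.integrableOn_compact (isCompact_closedBall _ _) ?_
    exact (continuousOn_rieszProfile s).comp (by fun_prop) hpos
  · filter_upwards [hP.quasiMeasurePreserving.ae
      (ae_restrict_mem (isClosed_tBall x r).measurableSet),
      ae_restrict_mem measurableSet_closedBall] with w hw hw'
    have := tdist_pos (hxy hw)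
    refine antitoneOn_rieszProfile s (pow_pos this 2) (hpos w hw') ?_
    gcongr
    exact hle w

theorem rieszK_mul_tHaar_tBall {d : ℕ} (s : ℝ) {x y : Torus d} (hxy : x ≠ y) (r : ℝ) :
    rieszK s x y * ((tHaar d (tBall x r) : ℝ≥0∞) : EReal) =
      ((((2 * Real.pi) ^ d)⁻¹ * (rieszProfile s (tdist x y ^ 2) * volume.real (tBall x r)) : ℝ) :
        EReal) := by
  have h : tHaar d (tBall x r) =
      ENNReal.ofReal (((2 * Real.pi) ^ d)⁻¹ * volume.real (tBall x r)) := by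
    rw [tHaar, Measure.smul_apply, smul_eq_mul, ENNReal.ofReal_mul (by positivity),
      ENNReal.ofReal_inv_of_pos (by positivity), ofReal_measureReal]
  rw [rieszK_eq_coe_rieszProfile s hxy, h, EReal.coe_ennreal_ofReal, max_eq_left (by positivity),
    ← EReal.coe_mul]
  congr 1
  ring

theorem eInt_tHaar_rieszK {d : ℕ} (s : ℝ) {x y : Torus d} {r : ℝ} (hxy : tBall x r ⊆ {y}ᶜ) :
    eInt (tHaar d) (tBall x r) (fun z ↦ rieszK s z y) =
      ((((2 * Real.pi) ^ d)⁻¹ * ∫ z in tBall x r, rieszProfile s (tdist z y ^ 2) : ℝ) : EReal) := by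
  have hint : IntegrableOn (fun z ↦ rieszProfile s (tdist z y ^ 2)) (tBall x r) :=
    ((continuousOn_rieszProfile_tdist s y).mono hxy).integrableOn_compact
      (isClosed_tBall x r).isCompact
  have hc : (ENNReal.ofReal ((2 * Real.pi) ^ d))⁻¹ ≠ ∞ := by
    rw [ENNReal.inv_ne_top]
    exact (ENNReal.ofReal_pos.2 (by positivity)).ne'
  rw [eInt_eq_coe_setIntegral (isClosed_tBall x r).measurableSet
    (f := fun z ↦ rieszProfile s (tdist z y ^ 2)) ?_
    fun z hz ↦ rieszK_eq_coe_rieszProfile s (hxy hz)]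
  · rw [tHaar, Measure.restrict_smul, integral_smul_measure, ENNReal.toReal_inv,
      ENNReal.toReal_ofReal (by positivity), smul_eq_mul]
  · rw [IntegrableOn, tHaar, Measure.restrict_smul]
    exact hint.smul_measure hc

/-- On the flat `d`-torus with the uniform measure, the Riesz kernel `K_s` is entirely
subharmonic for `s ≥ d − 2`, and entirely strictly subharmonic for `s > d − 2`. -/
theorem riesz_entirely_subharmonic_on_torus
    (d : ℕ) (hd : 1 ≤ d) (s : ℝ) (hs : (d : ℝ) - 2 ≤ s) :
    ∃ R > (0 : ℝ),
      (∀ y : Torus d,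
        (∀ x, x ≠ y → rieszK s x y ≠ ⊤ ∧ rieszK s x y ≠ ⊥) ∧
        ∀ (x₀ : Torus d) (r : ℝ), 0 < r → r < R → tBall x₀ r ⊆ {y}ᶜ →
          rieszK s x₀ y * ((tHaar d (tBall x₀ r) : ℝ≥0∞) : EReal) ≤
            eInt (tHaar d) (tBall x₀ r) (fun z => rieszK s z y)) ∧
      ((d : ℝ) - 2 < s → ∀ y : Torus d,
        ∀ (x₀ : Torus d) (r : ℝ), 0 < r → r < R → tBall x₀ r ⊆ {y}ᶜ →
          rieszK s x₀ y * ((tHaar d (tBall x₀ r) : ℝ≥0∞) : EReal) <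
            eInt (tHaar d) (tBall x₀ r) (fun z => rieszK s z y)) := by
  have hpi := Real.pi_gt_three
  have : NeZero d := ⟨by omega⟩
  obtain ⟨c, hc, hκ⟩ := exists_hasDerivAt_rieszProfile s
  have hvol : ∀ (x : Torus d) {r : ℝ}, r < Real.pi →
      volume.real (tBall x r) =
        volume.real (Metric.closedBall (0 : EuclideanSpace ℝ (Fin d)) r) := fun x r hr ↦ by
    have h := (measurePreserving_torusExp x hr).measure_preimage
      MeasurableSet.univ.nullMeasurableSet
    rw [preimage_univ, Measure.restrict_apply_univ, Measure.restrict_apply_univ] at h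
    rw [measureReal_def, measureReal_def, h]
  have hne : ∀ (y x : Torus d) {r : ℝ}, 0 < r → tBall x r ⊆ {y}ᶜ → x ≠ y := fun y x r hr h ↦
    h (show tdist x x ≤ r by simpa [tdist] using hr.le)
  have hinv : 0 < ((2 * Real.pi) ^ d)⁻¹ := by positivity
  refine ⟨1 / 2, by norm_num, fun y ↦ ⟨fun x hx ↦ ?_, fun x r hr hr' h ↦ ?_⟩,
    fun hs' y x r hr hr' h ↦ ?_⟩
  · rw [rieszK_eq_coe_rieszProfile s hx]
    exact ⟨EReal.coe_ne_top _, EReal.coe_ne_bot _⟩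
  · have hrπ : r < Real.pi := by linarith
    obtain ⟨e, hre, he, hle⟩ := exists_setIntegral_rieszProfile_le s hrπ h
    rw [rieszK_mul_tHaar_tBall s (hne y x hr h), eInt_tHaar_rieszK s h, EReal.coe_le_coe_iff,
      mul_le_mul_iff_right₀ hinv, ← he, hvol x hrπ]
    refine le_trans ?_ hle
    refine mul_measureReal_le_setIntegral_closedBall_radial volume hr hre hc hκ ?_
    rw [finrank_euclideanSpace_fin]
    linarith
  · have hrπ : r < Real.pi := by linarith
    obtain ⟨e, hre, he, hle⟩ := exists_setIntegral_rieszProfile_le s hrπ h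
    rw [rieszK_mul_tHaar_tBall s (hne y x hr h), eInt_tHaar_rieszK s h, EReal.coe_lt_coe_iff,
      mul_lt_mul_iff_right₀ hinv, ← he, hvol x hrπ]
    refine lt_of_lt_of_le ?_ hle
    refine mul_measureReal_lt_setIntegral_closedBall_radial volume hr hre hc hκ ?_
    rw [finrank_euclideanSpace_fin]
    linarith

end
end
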